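/- Let 𝒪 ⊂ ℝ^{m−k} × ℝ^n be open and let φ : 𝒪 → ℝᵏ be uniformly intrinsically differentiable at every point of 𝒪. Then for every A₀ ∈ 𝒪 there exist r > 0 and f ∈ C¹_G(U(Φ(A₀),r), ℝᵏ) such that graph(φ) ∩ U(Φ(A₀),r) = {P ∈ U(Φ(A₀),r) : f(P) = 0} and the k×k matrix M₁(Q) := (X_i f_j(Q))_{j,i=1,…,k} is invertible for every Q ∈ U(Φ(A₀),r). -/

import Mathlib

noncomputable section

open Set Filter Topology MeasureTheory

namespace Carnot

/-- Euclidean norm on `Fin d → ℝ`. -/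
def enorm {d : ℕ} (x : Fin d → ℝ) : ℝ := Real.sqrt (∑ i, (x i) ^ 2)

/-- The underlying set of the Carnot group `G = ℝ^m × ℝ^n` of class `𝓑`. -/
abbrev G (m n : ℕ) := (Fin m → ℝ) × (Fin n → ℝ)

/-- Points of the normal complement `W`, identified with `ℝ^(m-k) × ℝ^n`. -/
abbrev W (m n k : ℕ) := (Fin (m - k) → ℝ) × (Fin n → ℝ)

/-- The group law of the Carnot group of class `𝓑` associated with the
skew-symmetric matrices `b s`:
`(x,y)·(x',y') = (x + x', y + y' + ½⟨Bx,x'⟩)`. -/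
def gmul {m n : ℕ} (b : Fin n → Matrix (Fin m) (Fin m) ℝ) (P Q : G m n) : G m n :=
  (P.1 + Q.1, fun s => P.2 s + Q.2 s + (1 / 2) * ∑ i, ∑ j, b s i j * P.1 j * Q.1 i)

/-- The group inverse `(x,y)⁻¹ = (-x,-y)`. -/
def ginv {m n : ℕ} (P : G m n) : G m n := (-P.1, -P.2)

/-- The homogeneous quasi-norm `N(x,y) = |x| + |y|^(1/2)`. -/
def qnorm {m n : ℕ} (P : G m n) : ℝ := enorm P.1 + Real.sqrt (enorm P.2)

/-- Open ball for the quasi-norm: `U(P,r) = {Q : N(P⁻¹·Q) < r}`. -/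
def ball (m n : ℕ) (b : Fin n → Matrix (Fin m) (Fin m) ℝ) (P : G m n) (r : ℝ) : Set (G m n) :=
  {Q | qnorm (gmul b (ginv P) Q) < r}

/-- The embedding `i : ℝ^(m-k) × ℝ^n → G`, `i(a,α) = (0,…,0,a,α)`. -/
def embW (m n k : ℕ) (A : W m n k) : G m n :=
  (fun j => if h : (j : ℕ) < k then 0 else A.1 ⟨(j : ℕ) - k, by have := j.isLt; omega⟩, A.2)

/-- The embedding of `ℝ^k` as the horizontal subgroup `H`, `v ↦ (v,0,…,0)`. -/
def embH (m n k : ℕ) (v : Fin k → ℝ) : G m n :=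
  (fun j => if h : (j : ℕ) < k then v ⟨(j : ℕ), h⟩ else 0, 0)

/-- The graph map `Φ(A) = i(A)·φ̂(A)`. -/
def graphMap (m n k : ℕ) (b : Fin n → Matrix (Fin m) (Fin m) ℝ)
    (φ : W m n k → Fin k → ℝ) (A : W m n k) : G m n :=
  gmul b (embW m n k A) (embH m n k (φ A))

/-- `N(i(A)⁻¹·i(B))`. -/
def dW (m n k : ℕ) (b : Fin n → Matrix (Fin m) (Fin m) ℝ) (A B : W m n k) : ℝ :=
  qnorm (gmul b (ginv (embW m n k A)) (embW m n k B))

/-- The graph quasi-distance `σ_φ(A,B) = N(φ̂(A)⁻¹·i(A)⁻¹·i(B)·φ̂(A))`. -/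
def sigma (m n k : ℕ) (b : Fin n → Matrix (Fin m) (Fin m) ℝ)
    (φ : W m n k → Fin k → ℝ) (A B : W m n k) : ℝ :=
  qnorm (gmul b (gmul b (gmul b (ginv (embH m n k (φ A))) (ginv (embW m n k A)))
    (embW m n k B)) (embH m n k (φ A)))

/-- The matrix `M` satisfies the uniform intrinsic differentiability condition of `φ`
at `A₀ ∈ 𝒪`. -/
def UID (m n k : ℕ) (b : Fin n → Matrix (Fin m) (Fin m) ℝ) (O : Set (W m n k))
    (φ : W m n k → Fin k → ℝ) (A₀ : W m n k) (M : Matrix (Fin k) (Fin (m - k)) ℝ) : Prop :=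
  ∀ ε > 0, ∃ r > 0, ∀ A ∈ O, ∀ B ∈ O,
    dW m n k b A₀ A < r → dW m n k b A B < r → 0 < dW m n k b A B →
    enorm (fun j => φ B j - φ A j - ∑ i, M j i * (B.1 i - A.1 i)) ≤ ε * sigma m n k b φ A B

/-- `f : U → ℝ^k` is of class `C¹_G` with (continuous) horizontal Jacobian `gradf`. -/
def C1G (m n k : ℕ) (b : Fin n → Matrix (Fin m) (Fin m) ℝ) (U : Set (G m n))
    (f : G m n → Fin k → ℝ) (gradf : G m n → Matrix (Fin k) (Fin m) ℝ) : Prop :=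
  ContinuousOn f U ∧ ContinuousOn gradf U ∧
  ∀ P ∈ U, ∀ ε > 0, ∃ r > 0, ∀ Q ∈ U,
    qnorm (gmul b (ginv P) Q) < r →
    enorm (fun j => f Q j - f P j - ∑ i, gradf P j i * (Q.1 i - P.1 i)) ≤
      ε * qnorm (gmul b (ginv P) Q)

/-- The square block `M₁(Q) = (X_i f_j(Q))_{j,i=1,…,k}` of the horizontal Jacobian. -/
def M1 (m n k : ℕ) (hk : k ≤ m) (gradf : G m n → Matrix (Fin k) (Fin m) ℝ) (Q : G m n) :
    Matrix (Fin k) (Fin k) ℝ :=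
  Matrix.of fun j i => gradf Q j (Fin.castLE hk i)

/-- The block `M₂(Q) = (X_{k+i} f_j(Q))_{j=1,…,k; i=1,…,m-k}` of the horizontal Jacobian. -/
def M2 (m n k : ℕ) (gradf : G m n → Matrix (Fin k) (Fin m) ℝ) (Q : G m n) :
    Matrix (Fin k) (Fin (m - k)) ℝ :=
  Matrix.of fun j i => gradf Q j ⟨k + (i : ℕ), by have := i.isLt; omega⟩

section GaugeDistance

variable {E Y : Type*} [NormedAddCommGroup E] [NormedSpace ℝ E] [NormedAddCommGroup Y]
  [NormedSpace ℝ Y] (β : E →L[ℝ] E →L[ℝ] Y)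

/-- The homogeneous quasi-distance of the step two group on `E × Y` with law
`(x, y) · (x', y') = (x + x', y + y' + β x x')`, for alternating `β`. -/
def gdist (P Q : E × Y) : ℝ := max ‖Q.1 - P.1‖ √‖Q.2 - P.2 - β P.1 Q.1‖

variable {β}

lemma gdist_nonneg (P Q : E × Y) : 0 ≤ gdist β P Q := le_max_of_le_left (norm_nonneg _)

lemma gdist_le_iff {P Q : E × Y} {r : ℝ} (hr : 0 ≤ r) :
    gdist β P Q ≤ r ↔ ‖Q.1 - P.1‖ ≤ r ∧ ‖Q.2 - P.2 - β P.1 Q.1‖ ≤ r ^ 2 := by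
  simp [gdist, Real.sqrt_le_iff, hr]

lemma norm_fst_sub_le_gdist (P Q : E × Y) : ‖Q.1 - P.1‖ ≤ gdist β P Q := le_max_left _ _

lemma norm_snd_sub_le_gdist_sq (P Q : E × Y) :
    ‖Q.2 - P.2 - β P.1 Q.1‖ ≤ gdist β P Q ^ 2 :=
  ((gdist_le_iff (gdist_nonneg P Q)).1 le_rfl).2

lemma continuous_gdist : Continuous fun p : (E × Y) × (E × Y) => gdist β p.1 p.2 := by
  unfold gdist
  fun_prop

lemma skew_of_alternating (hβ : ∀ x, β x x = 0) (x y : E) : β x y = -β y x := by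
  have h := hβ (x + y)
  simp only [map_add, add_apply, hβ, zero_add, add_zero] at h
  exact eq_neg_of_add_eq_zero_right h

lemma gdist_self (hβ : ∀ x, β x x = 0) (P : E × Y) : gdist β P P = 0 := by
  simp [gdist, hβ]

lemma eq_of_gdist_eq_zero (hβ : ∀ x, β x x = 0) {P Q : E × Y} (h : gdist β P Q = 0) :
    P = Q := by
  obtain ⟨h1, h2⟩ := (gdist_le_iff le_rfl).1 h.le
  have h3 : Q.1 = P.1 := sub_eq_zero.1 (norm_le_zero_iff.1 h1)
  rw [h3, hβ] at h2
  have h4 : Q.2 - P.2 = 0 := by simpa using h2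
  exact Prod.ext h3.symm (sub_eq_zero.1 h4).symm

lemma gdist_comm (hβ : ∀ x, β x x = 0) (P Q : E × Y) : gdist β P Q = gdist β Q P := by
  have h : Q.2 - P.2 - β P.1 Q.1 = -(P.2 - Q.2 - β Q.1 P.1) := by
    rw [skew_of_alternating hβ P.1 Q.1]
    abel
  rw [gdist, gdist, h, norm_neg, norm_sub_rev]

lemma gdist_triangle (hβ : ∀ x, β x x = 0) (P Q R : E × Y) :
    gdist β P R ≤ (1 + ‖β‖) * (gdist β P Q + gdist β Q R) := by
  have hx := norm_fst_sub_le_gdist (β := β) P Q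
  have hx' := norm_fst_sub_le_gdist (β := β) Q R
  have hy := norm_snd_sub_le_gdist_sq (β := β) P Q
  have hy' := norm_snd_sub_le_gdist_sq (β := β) Q R
  have h0 := gdist_nonneg (β := β) P Q
  have h0' := gdist_nonneg (β := β) Q R
  have hb := norm_nonneg β
  set u := gdist β P Q
  set v := gdist β Q R
  refine (gdist_le_iff (by positivity)).2 ⟨?_, ?_⟩
  · calc ‖R.1 - P.1‖ = ‖(Q.1 - P.1) + (R.1 - Q.1)‖ := by congr 1; abel
      _ ≤ u + v := (norm_add_le _ _).trans (add_le_add hx hx')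
      _ ≤ (1 + ‖β‖) * (u + v) := by nlinarith
  · have e : R.2 - P.2 - β P.1 R.1 = (Q.2 - P.2 - β P.1 Q.1) + (R.2 - Q.2 - β Q.1 R.1)
        + β (Q.1 - P.1) (R.1 - Q.1) := by
      simp only [map_sub, sub_apply, hβ]
      abel
    have h3 : ‖β (Q.1 - P.1) (R.1 - Q.1)‖ ≤ ‖β‖ * u * v :=
      (β.le_opNorm₂ _ _).trans (by gcongr)
    rw [e]
    refine (norm_add₃_le).trans ((add_le_add_three hy hy' h3).trans ?_)
    nlinarith [mul_nonneg h0 h0', mul_nonneg hb (mul_nonneg h0 h0'), sq_nonneg ‖β‖,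
      mul_nonneg hb (sq_nonneg u), mul_nonneg hb (sq_nonneg v),
      mul_nonneg (sq_nonneg ‖β‖) (sq_nonneg (u + v))]

lemma norm_sub_le_gdist (hβ : ∀ x, β x x = 0) {P Q : E × Y} (h : gdist β P Q ≤ 1) :
    ‖Q - P‖ ≤ (1 + ‖β‖ * ‖P.1‖) * gdist β P Q := by
  have hx := norm_fst_sub_le_gdist (β := β) P Q
  have hy := norm_snd_sub_le_gdist_sq (β := β) P Q
  have h0 := gdist_nonneg (β := β) P Q
  set g := gdist β P Q
  have hz : 0 ≤ ‖β‖ * ‖P.1‖ := by positivity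
  have e : Q.2 - P.2 = (Q.2 - P.2 - β P.1 Q.1) + β P.1 (Q.1 - P.1) := by
    simp [map_sub, hβ]
  have h3 : ‖β P.1 (Q.1 - P.1)‖ ≤ ‖β‖ * ‖P.1‖ * g :=
    (β.le_opNorm₂ _ _).trans (by gcongr)
  rw [Prod.norm_def, max_le_iff]
  refine ⟨hx.trans (by nlinarith), ?_⟩
  change ‖Q.2 - P.2‖ ≤ _
  rw [e]
  refine (norm_add_le _ _).trans ((add_le_add hy h3).trans ?_)
  nlinarith

lemma exists_gdist_lt_subset (hβ : ∀ x, β x x = 0) {P : E × Y} {s : Set (E × Y)}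
    (hs : s ∈ 𝓝 P) : ∃ r > 0, ∀ Q, gdist β P Q < r → Q ∈ s := by
  obtain ⟨ε, hε, hb⟩ := Metric.mem_nhds_iff.1 hs
  have hc : 0 < 1 + ‖β‖ * ‖P.1‖ := by positivity
  refine ⟨min 1 (ε / (1 + ‖β‖ * ‖P.1‖)), by positivity, fun Q hQ => hb ?_⟩
  rw [Metric.mem_ball, dist_eq_norm]
  refine (norm_sub_le_gdist hβ (hQ.trans_le (min_le_left _ _)).le).trans_lt ?_
  rw [mul_comm]
  exact (lt_div_iff₀ hc).1 (hQ.trans_le (min_le_right _ _))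

end GaugeDistance

section Whitney

/-- A field of Whitney jets, vanishing to order zero, on a subset `Γ` of a step two group,
together with a quasi-nearest-point map from an open set `U` onto `Γ`. -/
structure WhitneyJet {m n : ℕ} (β : (Fin m → ℝ) →L[ℝ] (Fin m → ℝ) →L[ℝ] (Fin n → ℝ))
    (F : Type*) [NormedAddCommGroup F] [NormedSpace ℝ F] where
  alternating : ∀ x, β x x = 0
  Γ : Set (G m n)
  U : Set (G m n)
  isOpen_U : IsOpen U
  proj : G m n → G m n
  L : G m n → (Fin m → ℝ) →L[ℝ] F
  C : ℝ
  one_le_C : 1 ≤ C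
  proj_mem : ∀ P ∈ U, proj P ∈ Γ
  gdist_proj_le : ∀ P ∈ U, ∀ q ∈ Γ, gdist β (proj P) P ≤ C * gdist β q P
  whitney : ∀ q₀ ∈ Γ, ∀ ε > 0, ∃ s ∈ 𝓝 q₀, ∀ q₁ ∈ s ∩ Γ, ∀ q₂ ∈ s ∩ Γ,
    ‖L q₁ - L q₂‖ ≤ ε ∧ ∀ P : G m n,
      ‖L q₁ (P.1 - q₁.1) - L q₂ (P.1 - q₂.1)‖ ≤ ε * (gdist β q₁ P + gdist β q₂ P)

variable {m n : ℕ} {β : (Fin m → ℝ) →L[ℝ] (Fin m → ℝ) →L[ℝ] (Fin n → ℝ)}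

/-- Indices of lattice points: a dyadic scale and integer coordinates. -/
abbrev Cell (m n : ℕ) := ℤ × (Fin m → ℤ) × (Fin n → ℤ)

/-- The dyadic scale of a cell. -/
def Cell.scale (i : Cell m n) : ℝ := 2 ^ i.1

lemma Cell.scale_pos (i : Cell m n) : 0 < i.scale := zpow_pos two_pos _

/-- The horizontal coordinates of the lattice point of a cell, at unit scale. -/
def Cell.horiz (i : Cell m n) : Fin m → ℝ := fun l => i.2.1 l

/-- The vertical coordinates of the lattice point of a cell, at unit scale. -/
def Cell.vert (i : Cell m n) : Fin n → ℝ := fun l => i.2.2 l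

variable (β) in
/-- Group coordinates relative to the lattice point of a cell, dilated to unit scale. -/
def Cell.chart (i : Cell m n) (P : G m n) : G m n :=
  (i.scale⁻¹ • P.1 - i.horiz,
    (i.scale ^ 2)⁻¹ • P.2 - i.vert - i.scale⁻¹ • β i.horiz P.1)

variable (β) in
/-- The linear part of `Cell.chart`. -/
def Cell.chartL (i : Cell m n) : G m n →L[ℝ] G m n :=
  (i.scale⁻¹ • ContinuousLinearMap.fst ℝ _ _).prod
    ((i.scale ^ 2)⁻¹ • ContinuousLinearMap.snd ℝ _ _ -
      i.scale⁻¹ • (β i.horiz).comp (ContinuousLinearMap.fst ℝ _ _))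

lemma Cell.chart_eq (i : Cell m n) :
    i.chart β = fun P => i.chartL β P - (i.horiz, i.vert) := by
  funext P
  simp only [chart, chartL, ContinuousLinearMap.prod_apply, Prod.mk_sub_mk]
  refine Prod.ext rfl ?_
  simp [sub_right_comm]

lemma Cell.contDiff_chart (i : Cell m n) : ContDiff ℝ 1 (i.chart β) := by
  rw [i.chart_eq]
  exact (i.chartL β).contDiff.sub contDiff_const

lemma Cell.hasFDerivAt_chart (i : Cell m n) (P : G m n) :
    HasFDerivAt (i.chart β) (i.chartL β) P := by
  rw [i.chart_eq]
  exact (i.chartL β).hasFDerivAt.sub_const _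

variable (β) in
/-- The left invariant horizontal vector field with direction `ξ`, at `P`. -/
def leftInv (P : G m n) (ξ : Fin m → ℝ) : G m n := (ξ, β P.1 ξ)

lemma Cell.chartL_leftInv (i : Cell m n) (P : G m n) (ξ : Fin m → ℝ) :
    i.chartL β (leftInv β P ξ) = i.scale⁻¹ • leftInv β (i.chart β P) ξ := by
  refine Prod.ext rfl ?_
  simp only [chartL, leftInv, chart, ContinuousLinearMap.prod_apply, map_sub, map_smul,
    sub_apply, smul_apply, Prod.smul_snd, ContinuousLinearMap.coe_snd',
    ContinuousLinearMap.comp_apply, ContinuousLinearMap.coe_fst', smul_sub, smul_smul]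
  rw [← mul_inv, ← sq]

lemma Cell.gdist_center_le {i : Cell m n} {P : G m n} (h : ‖i.chart β P‖ ≤ 3) :
    gdist β (i.scale • i.horiz, i.scale ^ 2 • i.vert) P ≤ 3 * i.scale := by
  have hs := i.scale_pos
  obtain ⟨h1, h2⟩ := max_le_iff.1 (Prod.norm_def (x := i.chart β P) ▸ h)
  refine (gdist_le_iff (by positivity)).2 ⟨?_, ?_⟩
  · have e : P.1 - i.scale • i.horiz = i.scale • (i.chart β P).1 := by
      simp [chart, smul_sub, smul_smul, hs.ne']
    change ‖P.1 - i.scale • i.horiz‖ ≤ _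
    rw [e, norm_smul, Real.norm_of_nonneg hs.le]
    nlinarith
  · have e : P.2 - i.scale ^ 2 • i.vert - β (i.scale • i.horiz) P.1
        = i.scale ^ 2 • (i.chart β P).2 := by
      simp only [chart, smul_sub, smul_smul, map_smul, smul_apply]
      rw [mul_inv_cancel₀ (by positivity), one_smul, sq, mul_assoc, mul_inv_cancel₀ hs.ne',
        mul_one]
    change ‖P.2 - i.scale ^ 2 • i.vert - β (i.scale • i.horiz) P.1‖ ≤ _
    rw [e, norm_smul, Real.norm_of_nonneg (by positivity)]
    nlinarith [sq_nonneg i.scale, mul_le_mul_of_nonneg_left h2 (sq_nonneg i.scale)]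

lemma Cell.gdist_le (hβ : ∀ x, β x x = 0) {i : Cell m n} {P Q : G m n}
    (hP : ‖i.chart β P‖ ≤ 3) (hQ : ‖i.chart β Q‖ ≤ 3) :
    gdist β P Q ≤ (1 + ‖β‖) * (6 * i.scale) := by
  refine (gdist_triangle hβ P (i.scale • i.horiz, i.scale ^ 2 • i.vert) Q).trans ?_
  rw [gdist_comm hβ P]
  have := gdist_center_le hP
  have := gdist_center_le hQ
  have := norm_nonneg β
  gcongr
  linarith

lemma Cell.norm_chart_lt (hβ : ∀ x, β x x = 0) {i : Cell m n} {P Q : G m n}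
    (hP : ‖i.chart β P‖ < 2) (h : 4 * (1 + ‖β‖) * gdist β P Q ≤ i.scale) :
    ‖i.chart β Q‖ < 3 := by
  have hs := i.scale_pos
  have hb := norm_nonneg β
  obtain ⟨h1, h2⟩ := max_lt_iff.1 (Prod.norm_def (x := i.chart β P) ▸ hP)
  have hx := norm_fst_sub_le_gdist (β := β) P Q
  have hy := norm_snd_sub_le_gdist_sq (β := β) P Q
  have h0 := gdist_nonneg (β := β) P Q
  set g := gdist β P Q
  have hg : i.scale⁻¹ * g * (4 * (1 + ‖β‖)) ≤ 1 := by
    rw [mul_assoc, inv_mul_le_iff₀ hs]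
    linarith
  have hg0 : 0 ≤ i.scale⁻¹ * g := by positivity
  set c := i.scale⁻¹ * g with hc
  have e1 : (i.chart β Q).1 = (i.chart β P).1 + i.scale⁻¹ • (Q.1 - P.1) := by
    simp only [chart, smul_sub]
    abel
  have e2 : (i.chart β Q).2 = (i.chart β P).2 + (i.scale ^ 2)⁻¹ • (Q.2 - P.2 - β P.1 Q.1)
      + i.scale⁻¹ • β (i.chart β P).1 (Q.1 - P.1) := by
    simp only [chart, smul_sub, map_sub, map_smul, sub_apply, smul_apply, hβ, smul_smul,
      ← sq, inv_pow, smul_zero]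
    abel
  have n1 : ‖i.scale⁻¹ • (Q.1 - P.1)‖ ≤ c := by
    rw [norm_smul, Real.norm_of_nonneg (by positivity), hc]
    gcongr
  have n2 : ‖(i.scale ^ 2)⁻¹ • (Q.2 - P.2 - β P.1 Q.1)‖ ≤ c ^ 2 := by
    rw [norm_smul, Real.norm_of_nonneg (by positivity), hc, mul_pow, inv_pow]
    gcongr
  have n3 : ‖i.scale⁻¹ • β (i.chart β P).1 (Q.1 - P.1)‖ ≤ ‖β‖ * 2 * c := by
    rw [← map_smul]
    exact (β.le_opNorm₂ _ _).trans (by gcongr)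
  rw [Prod.norm_def, max_lt_iff, e1, e2]
  have hcb : c * ‖β‖ ≤ 1 / 4 := by nlinarith
  have hc4 : c ≤ 1 / 4 := by nlinarith
  constructor
  · linarith [norm_add_le (i.chart β P).1 (i.scale⁻¹ • (Q.1 - P.1))]
  · refine norm_add₃_le.trans_lt ?_
    nlinarith

variable (β) in
lemma Cell.exists_norm_chart_le_one (j : ℤ) (P : G m n) :
    ∃ i : Cell m n, i.1 = j ∧ ‖i.chart β P‖ ≤ 1 := by
  set δ : ℝ := 2 ^ j
  let u : Fin m → ℤ := fun l => round (δ⁻¹ * P.1 l)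
  let u' : Fin m → ℝ := fun l => u l
  let w : Fin n → ℤ := fun l => round ((δ ^ 2)⁻¹ * P.2 l - δ⁻¹ * β u' P.1 l)
  refine ⟨(j, u, w), rfl, ?_⟩
  rw [Prod.norm_def, max_le_iff, pi_norm_le_iff_of_nonneg zero_le_one,
    pi_norm_le_iff_of_nonneg zero_le_one]
  refine ⟨fun l => ?_, fun l => ?_⟩
  · exact (abs_sub_round (δ⁻¹ * P.1 l)).trans (by norm_num)
  · have := abs_sub_round ((δ ^ 2)⁻¹ * P.2 l - δ⁻¹ * β u' P.1 l)
    refine le_trans (le_of_eq ?_) (this.trans (by norm_num))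
    rw [Real.norm_eq_abs, sub_right_comm]
    rfl

lemma sub_floor_mem_Icc {x : ℝ} {u : ℤ} (h : |x - u| < 3) :
    u - ⌊x⌋ ∈ Finset.Icc (-3 : ℤ) 3 := by
  obtain ⟨h1, h2⟩ := abs_lt.1 h
  have h3 := Int.floor_le x
  have h4 := Int.lt_floor_add_one x
  rw [Finset.mem_Icc]
  constructor
  · have : (-4 : ℝ) < (u : ℝ) - ⌊x⌋ := by linarith
    have : (-4 : ℤ) < u - ⌊x⌋ := by exact_mod_cast this
    omega
  · have : (u : ℝ) - ⌊x⌋ < 4 := by linarith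
    have : u - ⌊x⌋ < 4 := by exact_mod_cast this
    omega

variable (β) in
/-- Boundedly many cells of comparable scale are close to a given point. -/
lemma Cell.exists_card_le (J : Finset ℤ) (P : G m n) :
    ∃ s : Finset (Cell m n), s.card ≤ J.card * (7 ^ m * 7 ^ n) ∧
      ∀ i : Cell m n, i.1 ∈ J → ‖i.chart β P‖ < 3 → i ∈ s := by
  classical
  let δ : ℤ → ℝ := fun j => 2 ^ j
  let u : ℤ → (Fin m → ℤ) → Fin m → ℤ := fun j v l => v l + ⌊(δ j)⁻¹ * P.1 l⌋
  let w : ℤ → (Fin m → ℤ) → (Fin n → ℤ) → Fin n → ℤ := fun j u v l =>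
    v l + ⌊((δ j) ^ 2)⁻¹ * P.2 l - (δ j)⁻¹ * β (fun l => (u l : ℝ)) P.1 l⌋
  let g : Cell m n → Cell m n := fun i => (i.1, u i.1 i.2.1, w i.1 (u i.1 i.2.1) i.2.2)
  refine ⟨(J ×ˢ (Fintype.piFinset fun _ => Finset.Icc (-3 : ℤ) 3) ×ˢ
    (Fintype.piFinset fun _ => Finset.Icc (-3 : ℤ) 3)).image g, ?_, ?_⟩
  · refine Finset.card_image_le.trans (le_of_eq ?_)
    simp [Finset.card_product, Fintype.card_piFinset]
  · rintro ⟨j, a, b⟩ hj h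
    obtain ⟨h1, h2⟩ := max_lt_iff.1 (Prod.norm_def (x := Cell.chart β (j, a, b) P) ▸ h)
    rw [pi_norm_lt_iff (by norm_num)] at h1 h2
    refine Finset.mem_image.2 ⟨(j, fun l => a l - ⌊(δ j)⁻¹ * P.1 l⌋, fun l =>
      b l - ⌊((δ j) ^ 2)⁻¹ * P.2 l - (δ j)⁻¹ * β (fun l => (a l : ℝ)) P.1 l⌋), ?_, ?_⟩
    · simp only [Finset.mem_product, Fintype.mem_piFinset]
      refine ⟨hj, fun l => sub_floor_mem_Icc (h1 l), fun l => sub_floor_mem_Icc ?_⟩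
      refine lt_of_eq_of_lt ?_ (h2 l)
      rw [Real.norm_eq_abs, sub_right_comm]
      rfl
    · simp [g, u, w]

end Whitney

section WhitneyCells

namespace WhitneyJet

variable {m n : ℕ} {β : (Fin m → ℝ) →L[ℝ] (Fin m → ℝ) →L[ℝ] (Fin n → ℝ)}
  {F : Type*} [NormedAddCommGroup F] [NormedSpace ℝ F] (D : WhitneyJet β F)

/-- The quasi-distance to `Γ`, measured through `proj`. -/
def height (P : G m n) : ℝ := gdist β (D.proj P) P

/-- The ratio between the height of a point and the scale of the cells around it. -/
def ratio : ℝ := 7 * D.C * (1 + ‖β‖) ^ 2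

/-- The bound for the distance between a point and the nodes of the cells around it, in
terms of the scale. -/
def reach : ℝ := (1 + ‖β‖) * (14 * D.C * (1 + ‖β‖) ^ 2 + 6 * (1 + ‖β‖))

/-- The cells containing a point of `U` whose height is comparable to the scale of the cell. -/
abbrev Index := {i : Cell m n // ∃ P ∈ D.U, D.ratio * i.scale ≤ D.height P ∧
  D.height P < 2 * (D.ratio * i.scale) ∧ ‖i.chart β P‖ ≤ 1}

/-- A point of `Γ` close to the cell. -/
def node (i : D.Index) : G m n := D.proj i.2.choose

lemma one_le_kappa (β : (Fin m → ℝ) →L[ℝ] (Fin m → ℝ) →L[ℝ] (Fin n → ℝ)) : 1 ≤ 1 + ‖β‖ :=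
  le_add_of_nonneg_right (norm_nonneg β)

lemma one_le_reach : 1 ≤ D.reach := by
  have h1 := one_le_kappa β
  have h2 := D.one_le_C
  unfold reach
  generalize 1 + ‖β‖ = κ at *
  have : 1 ≤ κ ^ 2 := one_le_pow₀ h1
  have : 1 ≤ D.C * κ ^ 2 := one_le_mul_of_one_le_of_one_le h2 this
  nlinarith

lemma node_mem (i : D.Index) : D.node i ∈ D.Γ := D.proj_mem _ i.2.choose_spec.1

lemma height_nonneg (P : G m n) : 0 ≤ D.height P := gdist_nonneg _ _

lemma height_le {P : G m n} (hP : P ∈ D.U) {q : G m n} (hq : q ∈ D.Γ) :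
    D.height P ≤ D.C * gdist β q P := D.gdist_proj_le P hP q hq

lemma height_pos {P : G m n} (hP : P ∈ D.U) (h : P ∉ D.Γ) : 0 < D.height P := by
  refine (D.height_nonneg P).lt_of_ne fun h0 => h ?_
  rw [← eq_of_gdist_eq_zero D.alternating h0.symm]
  exact D.proj_mem P hP

lemma height_eq_zero {P : G m n} (hP : P ∈ D.U) (h : P ∈ D.Γ) : D.height P = 0 := by
  refine le_antisymm ((D.height_le hP h).trans ?_) (D.height_nonneg P)
  rw [gdist_self D.alternating, mul_zero]

lemma height_le_height {P Q : G m n} (hP : P ∈ D.U) (hQ : Q ∈ D.U) :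
    D.height P ≤ D.C * ((1 + ‖β‖) * (D.height Q + gdist β Q P)) :=
  (D.height_le hP (D.proj_mem Q hQ)).trans
    (mul_le_mul_of_nonneg_left (gdist_triangle D.alternating _ _ _)
      (zero_le_one.trans D.one_le_C))

variable {D} in
lemma gdist_node_le (i : D.Index) {P : G m n} (h : ‖i.1.chart β P‖ < 3) :
    gdist β (D.node i) P ≤ D.reach * i.1.scale := by
  obtain ⟨hU, h1, h2, h3⟩ := i.2.choose_spec
  have hd := Cell.gdist_le D.alternating (h3.trans (by norm_num)) h.le
  have h4 : gdist β (D.node i) P ≤ (1 + ‖β‖) * (D.height i.2.choose + gdist β i.2.choose P) :=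
    gdist_triangle D.alternating _ _ _
  refine h4.trans ?_
  rw [reach, mul_assoc]
  have hκ := one_le_kappa β
  gcongr
  have h5 : D.height i.2.choose < 2 * (7 * D.C * (1 + ‖β‖) ^ 2 * i.1.scale) := h2
  linarith

variable {D} in
lemma scale_le_height (i : D.Index) {P : G m n} (hP : P ∈ D.U) (h : ‖i.1.chart β P‖ < 3) :
    i.1.scale ≤ D.height P := by
  obtain ⟨hU, h1, h2, h3⟩ := i.2.choose_spec
  have hd := Cell.gdist_le D.alternating h.le (h3.trans (by norm_num))
  have h4 : 7 * D.C * (1 + ‖β‖) ^ 2 * i.1.scale ≤ _ := (h1.trans (D.height_le_height hU hP)).trans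
    (mul_le_mul_of_nonneg_left (mul_le_mul_of_nonneg_left (add_le_add_right hd _)
      (zero_le_one.trans (one_le_kappa β))) (zero_le_one.trans D.one_le_C))
  have hκ := one_le_kappa β
  have hC := D.one_le_C
  have hs := i.1.scale_pos
  generalize 1 + ‖β‖ = κ at *
  have h5 : D.C * κ * (κ * i.1.scale) ≤ D.C * κ * D.height P := by nlinarith
  have h6 := le_of_mul_le_mul_left h5 (by positivity)
  nlinarith

variable {D} in
lemma height_le_scale (i : D.Index) {P : G m n} (hP : P ∈ D.U) (h : ‖i.1.chart β P‖ < 3) :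
    D.height P ≤ D.C * D.reach * i.1.scale := by
  refine (D.height_le hP (D.node_mem i)).trans ?_
  rw [mul_assoc]
  exact mul_le_mul_of_nonneg_left (gdist_node_le i h) (zero_le_one.trans D.one_le_C)

lemma ratio_pos : 0 < D.ratio := by
  have hκ := one_le_kappa β
  have hC := D.one_le_C
  unfold ratio
  positivity

lemma exists_index {P : G m n} (hP : P ∈ D.U) (h : P ∉ D.Γ) :
    ∃ i : D.Index, ‖i.1.chart β P‖ ≤ 1 := by
  have ht := D.height_pos hP h
  have hK := D.ratio_pos
  obtain ⟨j, hj⟩ := exists_mem_Ico_zpow (div_pos ht hK) (one_lt_two (α := ℝ))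
  obtain ⟨i, rfl, hi⟩ := Cell.exists_norm_chart_le_one β j P
  refine ⟨⟨i, P, hP, ?_, ?_, hi⟩, hi⟩
  · have := (le_div_iff₀ hK).1 hj.1
    rw [Cell.scale]
    linarith
  · have := (div_lt_iff₀ hK).1 hj.2
    rw [zpow_add_one₀ two_ne_zero] at this
    rw [Cell.scale]
    linarith

/-- The cells around a point of `U` off `Γ` are finite in number, with a uniform bound. -/
lemma exists_card_le : ∃ N : ℕ, ∀ P ∈ D.U, P ∉ D.Γ → ∃ s : Finset D.Index, s.card ≤ N ∧
    ∀ i : D.Index, i ∈ s ↔ ‖i.1.chart β P‖ < 3 := by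
  classical
  obtain ⟨S, hS⟩ := pow_unbounded_of_one_lt (D.C * D.reach) (one_lt_two (α := ℝ))
  refine ⟨(S + 2) * (7 ^ m * 7 ^ n), fun P hP h => ?_⟩
  have ht := D.height_pos hP h
  obtain ⟨j, hj⟩ := exists_mem_Ico_zpow ht (one_lt_two (α := ℝ))
  obtain ⟨s, hs, hs'⟩ := Cell.exists_card_le β (Finset.Icc (j - S) (j + 1)) P
  have hmem : ∀ i : D.Index, ‖i.1.chart β P‖ < 3 → i.1 ∈ s := by
    intro i hi
    refine hs' i.1 (Finset.mem_Icc.2 ⟨?_, ?_⟩) hi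
    · have h1 := hj.1.trans (height_le_scale i hP hi)
      have h2 : (2 : ℝ) ^ j < 2 ^ ((S : ℤ) + i.1.1) := by
        rw [zpow_add₀ two_ne_zero, zpow_natCast]
        exact h1.trans_lt (mul_lt_mul_of_pos_right hS i.1.scale_pos)
      have := (zpow_lt_zpow_iff_right₀ (one_lt_two (α := ℝ))).1 h2
      omega
    · have h1 : (2 : ℝ) ^ i.1.1 < 2 ^ (j + 1) := (scale_le_height i hP hi).trans_lt hj.2
      exact ((zpow_lt_zpow_iff_right₀ (one_lt_two (α := ℝ))).1 h1).le
  refine ⟨(s.subtype _).filter fun i => ‖i.1.chart β P‖ < 3, ?_, fun i => ?_⟩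
  · refine (Finset.card_filter_le _ _).trans ?_
    rw [Finset.card_subtype]
    refine (Finset.card_filter_le _ _).trans (hs.trans (le_of_eq ?_))
    rw [Int.card_Icc]
    congr 1
    omega
  · simp only [Finset.mem_filter, Finset.mem_subtype]
    exact ⟨fun h => h.2, fun h => ⟨hmem i h, h⟩⟩

/-- Cells meeting a small neighbourhood of `P` are among the cells around `P`. -/
lemma eventually_norm_chart_lt {P : G m n} (hP : P ∈ D.U) (h : P ∉ D.Γ) :
    ∀ᶠ Q in 𝓝 P, ∀ i : D.Index, ‖i.1.chart β Q‖ < 2 → ‖i.1.chart β P‖ < 3 := by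
  have ht := D.height_pos hP h
  have hκ := one_le_kappa β
  have hC := D.one_le_C
  have hR := D.one_le_reach
  have hc : ContinuousAt (fun Q => gdist β Q P) P :=
    (continuous_gdist.comp (continuous_id.prodMk continuous_const)).continuousAt
  have hlt : gdist β P P < D.height P / (8 * D.C ^ 2 * (1 + ‖β‖) ^ 2 * D.reach) := by
    rw [gdist_self D.alternating]
    positivity
  filter_upwards [hc.eventually_lt_const hlt, D.isOpen_U.mem_nhds hP] with Q hQ hQU i hi
  refine Cell.norm_chart_lt D.alternating hi ?_
  have h1 := D.height_le_height hP hQU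
  have h2 := height_le_scale i hQU (hi.trans (by norm_num))
  rw [lt_div_iff₀ (by positivity)] at hQ
  have hg := gdist_nonneg (β := β) Q P
  generalize 1 + ‖β‖ = κ at *
  generalize gdist β Q P = g at *
  generalize D.height P = t at *
  have hκg : D.C * κ * g * 2 ≤ t := by
    refine le_trans ?_ hQ.le
    have : 1 ≤ D.C * κ * D.reach := one_le_mul_of_one_le_of_one_le
      (one_le_mul_of_one_le_of_one_le hC hκ) hR
    have h3 : 0 ≤ D.C * κ * g := by positivity
    nlinarith
  have h4 : t ≤ 2 * (D.C * κ * (D.C * D.reach * i.1.scale)) := by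
    have : D.C * κ * D.height Q ≤ D.C * κ * (D.C * D.reach * i.1.scale) := by gcongr
    linarith
  have h5 : (2 * D.C ^ 2 * κ * D.reach) * (4 * κ * g) ≤
      (2 * D.C ^ 2 * κ * D.reach) * i.1.scale := by nlinarith
  exact le_of_mul_le_mul_left h5 (by positivity)

end WhitneyJet

end WhitneyCells

section WhitneyExtension

variable {m n : ℕ} {β : (Fin m → ℝ) →L[ℝ] (Fin m → ℝ) →L[ℝ] (Fin n → ℝ)}
  {F : Type*} [NormedAddCommGroup F] [NormedSpace ℝ F]

/-- A bump function on the group, equal to one on the unit ball. -/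
def unitBump (m n : ℕ) : ContDiffBump (0 : G m n) := ⟨1, 2, one_pos, one_lt_two⟩

lemma exists_fderiv_unitBump_le (β : (Fin m → ℝ) →L[ℝ] (Fin m → ℝ) →L[ℝ] (Fin n → ℝ)) :
    ∃ c, 0 ≤ c ∧ ∀ (S : G m n) (ξ : Fin m → ℝ),
      ‖fderiv ℝ (unitBump m n) S (leftInv β S ξ)‖ ≤ c * ‖ξ‖ := by
  have hcs : HasCompactSupport (fderiv ℝ (unitBump m n)) :=
    (unitBump m n).hasCompactSupport.fderiv (𝕜 := ℝ)
  have hcont : Continuous (fderiv ℝ (unitBump m n)) :=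
    (unitBump m n).contDiff.continuous_fderiv (n := 1) one_ne_zero
  obtain ⟨c, hc⟩ := hcont.bounded_above_of_compact_support hcs
  have hc0 : 0 ≤ c := (norm_nonneg _).trans (hc 0)
  refine ⟨c * (1 + ‖β‖ * 2), by positivity, fun S ξ => ?_⟩
  by_cases hS : S ∈ tsupport (unitBump m n)
  · rw [(unitBump m n).tsupport_eq, mem_closedBall_zero_iff] at hS
    refine (ContinuousLinearMap.le_opNorm _ _).trans ?_
    rw [mul_assoc]
    refine mul_le_mul (hc S) ?_ (norm_nonneg _) hc0
    have h1 : ‖β S.1 ξ‖ ≤ ‖β‖ * 2 * ‖ξ‖ := by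
      refine (β.le_opNorm₂ _ _).trans ?_
      gcongr
      exact (norm_fst_le S).trans hS
    refine max_le ?_ (h1.trans ?_)
    · change ‖ξ‖ ≤ _
      nlinarith [norm_nonneg ξ, norm_nonneg β, mul_nonneg (norm_nonneg β) (norm_nonneg ξ)]
    · nlinarith [norm_nonneg ξ]
  · have : fderiv ℝ (unitBump m n) S = 0 := by
      by_contra h
      exact hS (support_fderiv_subset ℝ h)
    rw [this, zero_apply, norm_zero]
    positivity

namespace WhitneyJet

variable (D : WhitneyJet β F)

/-- The weight of a cell. -/
def weight (i : D.Index) (P : G m n) : ℝ := unitBump m n (i.1.chart β P)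

/-- The total weight. -/
def den (P : G m n) : ℝ := ∑ᶠ i, D.weight i P

/-- The affine approximation given by the jet at `q`. -/
def affine (q P : G m n) : F := D.L q (P.1 - q.1)

/-- The weighted sum of the affine approximations at the nodes. -/
def num (P : G m n) : F := ∑ᶠ i, D.weight i P • D.affine (D.node i) P

/-- The Whitney extension of the jet. -/
def extension (P : G m n) : F := (D.den P)⁻¹ • D.num P

variable {D}

lemma weight_nonneg (i : D.Index) (P : G m n) : 0 ≤ D.weight i P := (unitBump m n).nonneg

lemma norm_chart_lt_of_weight_ne_zero {i : D.Index} {P : G m n} (h : D.weight i P ≠ 0) :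
    ‖i.1.chart β P‖ < 2 := by
  have : i.1.chart β P ∈ Function.support (unitBump m n) := h
  rwa [(unitBump m n).support_eq, mem_ball_zero_iff] at this

lemma contDiff_weight (i : D.Index) : ContDiff ℝ 1 (D.weight i) :=
  (unitBump m n).contDiff.comp i.1.contDiff_chart

lemma contDiff_affine (q : G m n) : ContDiff ℝ 1 (D.affine q) :=
  (D.L q).contDiff.comp (contDiff_fst.sub contDiff_const)

variable (D) in
lemma hasFDerivAt_affine (q P : G m n) :
    HasFDerivAt (D.affine q) ((D.L q).comp (ContinuousLinearMap.fst ℝ _ _)) P :=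
  (D.L q).hasFDerivAt.comp P (hasFDerivAt_fst.sub_const _)

lemma den_eq_sum {s : Finset D.Index} {P : G m n}
    (h : ∀ i : D.Index, ‖i.1.chart β P‖ < 2 → i ∈ s) : D.den P = ∑ i ∈ s, D.weight i P :=
  finsum_eq_sum_of_support_subset _ fun i hi => h i (norm_chart_lt_of_weight_ne_zero hi)

lemma num_eq_sum {s : Finset D.Index} {P : G m n}
    (h : ∀ i : D.Index, ‖i.1.chart β P‖ < 2 → i ∈ s) :
    D.num P = ∑ i ∈ s, D.weight i P • D.affine (D.node i) P :=
  finsum_eq_sum_of_support_subset _ fun i hi =>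
    h i (norm_chart_lt_of_weight_ne_zero fun h0 => hi (by simp [h0]))

lemma extension_eq_zero {P : G m n} (hP : P ∈ D.U) (h : P ∈ D.Γ) : D.extension P = 0 := by
  rw [extension, num_eq_sum (s := ∅), Finset.sum_empty, smul_zero]
  intro i hi
  have h1 := scale_le_height i hP (hi.trans (by norm_num))
  rw [D.height_eq_zero hP h] at h1
  exact absurd i.1.scale_pos h1.not_gt

lemma isOpen_U_diff : IsOpen (D.U \ D.Γ) := by
  rw [isOpen_iff_mem_nhds]
  rintro P ⟨hP, h⟩
  obtain ⟨i, hi⟩ := D.exists_index hP h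
  have h1 : {Q | ‖i.1.chart β Q‖ < 3} ∈ 𝓝 P :=
    (isOpen_lt i.1.contDiff_chart.continuous.norm continuous_const).mem_nhds
      (hi.trans_lt (by norm_num))
  filter_upwards [h1, D.isOpen_U.mem_nhds hP] with Q hQ hQU
  refine ⟨hQU, fun hQΓ => ?_⟩
  have h1 := scale_le_height i hQU hQ
  rw [D.height_eq_zero hQU hQΓ] at h1
  exact absurd i.1.scale_pos h1.not_gt

section OffSet

variable {P : G m n} {s : Finset D.Index}

lemma one_le_sum_weight (hP : P ∈ D.U) (h : P ∉ D.Γ)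
    (hs : ∀ i : D.Index, i ∈ s ↔ ‖i.1.chart β P‖ < 3) : 1 ≤ ∑ i ∈ s, D.weight i P := by
  obtain ⟨i, hi⟩ := D.exists_index hP h
  have h1 : D.weight i P = 1 :=
    (unitBump m n).one_of_mem_closedBall (mem_closedBall_zero_iff.2 hi)
  rw [← h1]
  exact Finset.single_le_sum (f := fun i => D.weight i P) (fun i _ => weight_nonneg i P)
    ((hs i).2 (hi.trans_lt (by norm_num)))

lemma extension_eventuallyEq (hP : P ∈ D.U) (h : P ∉ D.Γ)
    (hs : ∀ i : D.Index, i ∈ s ↔ ‖i.1.chart β P‖ < 3) :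
    D.extension =ᶠ[𝓝 P] fun Q => (∑ i ∈ s, D.weight i Q)⁻¹ •
      ∑ i ∈ s, D.weight i Q • D.affine (D.node i) Q := by
  filter_upwards [D.eventually_norm_chart_lt hP h] with Q hQ
  rw [extension, den_eq_sum fun i hi => (hs i).2 (hQ i hi),
    num_eq_sum fun i hi => (hs i).2 (hQ i hi)]

lemma contDiffAt_extension (hP : P ∈ D.U) (h : P ∉ D.Γ) : ContDiffAt ℝ 1 D.extension P := by
  obtain ⟨N, hN⟩ := D.exists_card_le
  obtain ⟨s, -, hs⟩ := hN P hP h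
  refine ContDiffAt.congr_of_eventuallyEq ?_ (extension_eventuallyEq hP h hs)
  refine ContDiffAt.smul (ContDiffAt.inv ?_ ?_) ?_
  · exact ContDiffAt.sum fun i _ => (contDiff_weight i).contDiffAt
  · exact (zero_lt_one.trans_le (one_le_sum_weight hP h hs)).ne'
  · exact ContDiffAt.sum fun i _ =>
      ((contDiff_weight i).smul (contDiff_affine _)).contDiffAt

lemma sum_weight_smul_eventuallyEq (hP : P ∈ D.U) (h : P ∉ D.Γ)
    (hs : ∀ i : D.Index, i ∈ s ↔ ‖i.1.chart β P‖ < 3) (q : G m n) :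
    (fun Q => (∑ i ∈ s, D.weight i Q) • (D.extension Q - D.affine q Q)) =ᶠ[𝓝 P] fun Q =>
      ∑ i ∈ s, D.weight i Q • (D.affine (D.node i) Q - D.affine q Q) := by
  have hcont : ContinuousAt (fun Q => ∑ i ∈ s, D.weight i Q) P :=
    (continuous_finsetSum _ fun i _ => (contDiff_weight i).continuous).continuousAt
  filter_upwards [extension_eventuallyEq hP h hs,
    hcont.eventually_const_lt (zero_lt_one.trans_le (one_le_sum_weight hP h hs))] with Q hQ hW
  rw [hQ, smul_sub, smul_smul, mul_inv_cancel₀ hW.ne', one_smul]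
  simp only [smul_sub, Finset.sum_sub_distrib, Finset.sum_smul]

lemma norm_extension_sub_affine_le (hP : P ∈ D.U) (h : P ∉ D.Γ) (q : G m n) {e : ℝ}
    (he : ∀ i : D.Index, ‖i.1.chart β P‖ < 3 →
      ‖D.affine (D.node i) P - D.affine q P‖ ≤ e) :
    ‖D.extension P - D.affine q P‖ ≤ e := by
  obtain ⟨N, hN⟩ := D.exists_card_le
  obtain ⟨s, -, hs⟩ := hN P hP h
  have hW := one_le_sum_weight hP h hs
  have h1 := (sum_weight_smul_eventuallyEq hP h hs q).eq_of_nhds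
  have h2 : (∑ i ∈ s, D.weight i P) * ‖D.extension P - D.affine q P‖ ≤
      (∑ i ∈ s, D.weight i P) * e := by
    rw [← Real.norm_of_nonneg (zero_le_one.trans hW), ← norm_smul, h1,
      Real.norm_of_nonneg (zero_le_one.trans hW), Finset.sum_mul]
    refine norm_sum_le_of_le _ fun i hi => ?_
    rw [norm_smul, Real.norm_of_nonneg (weight_nonneg i P)]
    exact mul_le_mul_of_nonneg_left (he i ((hs i).1 hi)) (weight_nonneg i P)
  exact le_of_mul_le_mul_left h2 (by linarith)

end OffSet

variable (D) in
lemma exists_fderiv_weight_le : ∃ c, 0 ≤ c ∧ ∀ P ∈ D.U, P ∉ D.Γ → ∀ i : D.Index,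
    ‖i.1.chart β P‖ < 3 → ∀ ξ,
      ‖fderiv ℝ (D.weight i) P (leftInv β P ξ)‖ * D.height P ≤ c * ‖ξ‖ := by
  obtain ⟨c, hc0, hc⟩ := exists_fderiv_unitBump_le (m := m) (n := n) β
  have hC := D.one_le_C
  have hR := D.one_le_reach
  refine ⟨c * (D.C * D.reach), by positivity, fun P hP h i hi ξ => ?_⟩
  have hs := i.1.scale_pos
  have h1 : fderiv ℝ (D.weight i) P =
      (fderiv ℝ (unitBump m n) (i.1.chart β P)).comp (i.1.chartL β) :=
    (((unitBump m n).contDiff.differentiable one_ne_zero _).hasFDerivAt.comp P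
      (i.1.hasFDerivAt_chart P)).fderiv
  rw [h1, ContinuousLinearMap.comp_apply, i.1.chartL_leftInv, map_smul, norm_smul,
    Real.norm_of_nonneg (inv_nonneg.2 hs.le)]
  calc _ ≤ i.1.scale⁻¹ * (c * ‖ξ‖) * (D.C * D.reach * i.1.scale) := by
        gcongr
        · exact D.height_nonneg P
        · exact hc _ _
        · exact height_le_scale i hP hi
    _ = c * (D.C * D.reach) * ‖ξ‖ := by field_simp

variable (D) in
lemma exists_fderiv_extension_sub_le : ∃ c, 0 ≤ c ∧ ∀ P ∈ D.U, P ∉ D.Γ → ∀ q e, 0 ≤ e →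
    (∀ i : D.Index, ‖i.1.chart β P‖ < 3 → ‖D.L (D.node i) - D.L q‖ ≤ e ∧
      ‖D.affine (D.node i) P - D.affine q P‖ ≤ e * D.height P) →
    ∀ ξ, ‖fderiv ℝ D.extension P (leftInv β P ξ) - D.L q ξ‖ ≤ c * e * ‖ξ‖ := by
  obtain ⟨c, hc0, hc⟩ := D.exists_fderiv_weight_le
  obtain ⟨N, hN⟩ := D.exists_card_le
  refine ⟨1 + 2 * (N * c), by positivity, fun P hP h q e he H ξ => ?_⟩
  obtain ⟨s, hsN, hs⟩ := hN P hP h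
  have hW := one_le_sum_weight hP h hs
  have ht := D.height_pos hP h
  have hg := norm_extension_sub_affine_le hP h q fun i hi => (H i hi).2
  have hw : ∀ i, HasFDerivAt (D.weight i) (fderiv ℝ (D.weight i) P) P := fun i =>
    ((contDiff_weight i).differentiable one_ne_zero P).hasFDerivAt
  have hf : HasFDerivAt D.extension (fderiv ℝ D.extension P) P :=
    ((contDiffAt_extension hP h).differentiableAt one_ne_zero).hasFDerivAt
  have hl := (HasFDerivAt.fun_sum fun i (_ : i ∈ s) => hw i).smul
    (hf.sub (D.hasFDerivAt_affine q P))
  have hr := HasFDerivAt.fun_sum fun i (_ : i ∈ s) =>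
    (hw i).smul ((D.hasFDerivAt_affine (D.node i) P).sub (D.hasFDerivAt_affine q P))
  have key := congrArg (fun A => A (leftInv β P ξ))
    (hl.unique (hr.congr_of_eventuallyEq (sum_weight_smul_eventuallyEq hP h hs q)))
  simp only [add_apply, smul_apply, sub_apply, ContinuousLinearMap.smulRight_apply,
    sum_apply, ContinuousLinearMap.comp_apply,
    ContinuousLinearMap.coe_fst', Pi.sub_apply] at key
  set X := leftInv β P ξ with hX
  have hX1 : X.1 = ξ := rfl
  rw [hX1] at key
  set W := ∑ i ∈ s, D.weight i P
  set v := fderiv ℝ D.extension P X - D.L q ξ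
  have hdw : ∑ i ∈ s, ‖fderiv ℝ (D.weight i) P X‖ * D.height P ≤ N * c * ‖ξ‖ := by
    refine (Finset.sum_le_card_nsmul s _ (c * ‖ξ‖) fun i hi =>
      hc P hP h i ((hs i).1 hi) ξ).trans ?_
    rw [nsmul_eq_mul, mul_assoc]
    gcongr
  have hA : ‖(∑ i ∈ s, fderiv ℝ (D.weight i) P X) • (D.extension P - D.affine q P)‖ ≤
      N * c * ‖ξ‖ * e := by
    rw [norm_smul]
    calc _ ≤ (∑ i ∈ s, ‖fderiv ℝ (D.weight i) P X‖) * (e * D.height P) := by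
          gcongr
          exact norm_sum_le _ _
      _ = (∑ i ∈ s, ‖fderiv ℝ (D.weight i) P X‖ * D.height P) * e := by
          rw [← Finset.sum_mul]
          ring
      _ ≤ _ := by gcongr
  have hB : ‖∑ i ∈ s, (D.weight i P • (D.L (D.node i) ξ - D.L q ξ) +
      fderiv ℝ (D.weight i) P X • (D.affine (D.node i) P - D.affine q P))‖ ≤
      W * (e * ‖ξ‖) + N * c * ‖ξ‖ * e := by
    rw [Finset.sum_add_distrib]
    refine (norm_add_le _ _).trans (add_le_add ?_ ?_)
    · rw [Finset.sum_mul]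
      refine norm_sum_le_of_le _ fun i hi => ?_
      rw [norm_smul, Real.norm_of_nonneg (weight_nonneg i P), ← sub_apply]
      exact mul_le_mul_of_nonneg_left ((ContinuousLinearMap.le_opNorm _ _).trans
        (mul_le_mul_of_nonneg_right (H i ((hs i).1 hi)).1 (norm_nonneg _))) (weight_nonneg i P)
    · refine le_trans ?_ (mul_le_mul_of_nonneg_right hdw he)
      rw [Finset.sum_mul]
      refine norm_sum_le_of_le _ fun i hi => ?_
      rw [norm_smul]
      refine (mul_le_mul_of_nonneg_left (H i ((hs i).1 hi)).2 (norm_nonneg _)).trans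
        (le_of_eq (by ring))
  have hC : ‖W • v‖ ≤ W * (e * ‖ξ‖) + N * c * ‖ξ‖ * e + N * c * ‖ξ‖ * e := by
    rw [eq_sub_of_add_eq key]
    exact (norm_sub_le _ _).trans (add_le_add hB hA)
  rw [norm_smul, Real.norm_of_nonneg (zero_le_one.trans hW)] at hC
  have h0 : 0 ≤ N * c * ‖ξ‖ * e := by positivity
  refine le_of_mul_le_mul_left (hC.trans ?_) (zero_lt_one.trans_le hW)
  nlinarith [mul_le_mul_of_nonneg_right hW h0]

end WhitneyJet

end WhitneyExtension

section WhitneyRegularity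

variable {m n : ℕ} {β : (Fin m → ℝ) →L[ℝ] (Fin m → ℝ) →L[ℝ] (Fin n → ℝ)}
  {F : Type*} [NormedAddCommGroup F] [NormedSpace ℝ F]

namespace WhitneyJet

variable (D : WhitneyJet β F)

open Classical in
/-- The horizontal Jacobian of the Whitney extension. -/
def jac (P : G m n) : (Fin m → ℝ) →L[ℝ] F :=
  if P ∈ D.Γ then D.L P
  else (fderiv ℝ D.extension P).comp ((ContinuousLinearMap.id ℝ _).prod (β P.1))

variable {D}

lemma jac_of_mem {P : G m n} (h : P ∈ D.Γ) : D.jac P = D.L P := if_pos h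

lemma jac_of_notMem {P : G m n} (h : P ∉ D.Γ) : D.jac P =
    (fderiv ℝ D.extension P).comp ((ContinuousLinearMap.id ℝ _).prod (β P.1)) := if_neg h

lemma gdist_node_le_height {P : G m n} (hP : P ∈ D.U) (i : D.Index)
    (hi : ‖i.1.chart β P‖ < 3) : gdist β (D.node i) P ≤ D.reach * D.height P :=
  (gdist_node_le i hi).trans (mul_le_mul_of_nonneg_left (scale_le_height i hP hi)
    (zero_le_one.trans D.one_le_reach))

lemma eventually_nodes_mem {q : G m n} (hq : q ∈ D.Γ) {s : Set (G m n)} (hs : s ∈ 𝓝 q) :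
    ∀ᶠ P in 𝓝 q, P ∈ D.U → D.proj P ∈ s ∧
      ∀ i : D.Index, ‖i.1.chart β P‖ < 3 → D.node i ∈ s := by
  obtain ⟨r, hr, hrs⟩ := exists_gdist_lt_subset D.alternating hs
  have hκ := one_le_kappa β
  have hC := D.one_le_C
  have hR := D.one_le_reach
  have hc : ContinuousAt (fun P => gdist β q P) q :=
    (continuous_gdist.comp (continuous_const.prodMk continuous_id)).continuousAt
  have hlt : gdist β q q < r / ((1 + ‖β‖) * (1 + D.reach * D.C)) := by
    rw [gdist_self D.alternating]
    positivity
  filter_upwards [hc.eventually_lt_const hlt] with P hP hPU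
  rw [lt_div_iff₀ (by positivity)] at hP
  have hg := gdist_nonneg (β := β) q P
  have hh := D.height_le hPU hq
  have hh0 := D.height_nonneg P
  have key : ∀ q', gdist β q' P ≤ D.reach * D.height P → q' ∈ s := by
    intro q' hq'
    refine hrs q' ((gdist_triangle D.alternating q P q').trans_lt (lt_of_le_of_lt ?_ hP))
    rw [gdist_comm D.alternating P q']
    have : D.reach * D.height P ≤ D.reach * (D.C * gdist β q P) := by gcongr
    calc (1 + ‖β‖) * (gdist β q P + gdist β q' P)
        ≤ (1 + ‖β‖) * (gdist β q P + D.reach * (D.C * gdist β q P)) := by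
          gcongr
          linarith
      _ = _ := by ring
  refine ⟨key _ ?_, fun i hi => key _ (gdist_node_le_height hPU i hi)⟩
  change D.height P ≤ _
  nlinarith

lemma eventually_extension {q : G m n} (hq : q ∈ D.Γ) (hqU : q ∈ D.U) {ε : ℝ} (hε : 0 < ε) :
    ∀ᶠ P in 𝓝 q, ‖D.extension P - D.L q (P.1 - q.1)‖ ≤ ε * gdist β q P ∧
      ‖D.jac P - D.L q‖ ≤ ε := by
  obtain ⟨c, hc0, hc⟩ := D.exists_fderiv_extension_sub_le
  have hC := D.one_le_C
  have hR := D.one_le_reach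
  obtain ⟨δ, hδ, h1, h2, h3⟩ : ∃ δ > 0, δ ≤ ε ∧ δ * (D.reach * D.C + 1) ≤ ε ∧
      c * (δ * (D.reach + 1)) + δ ≤ ε := by
    have hA : 0 < (1 + c) * (D.reach * D.C + D.reach + 1) := by positivity
    refine ⟨ε / ((1 + c) * (D.reach * D.C + D.reach + 1)), by positivity, ?_⟩
    set δ := ε / ((1 + c) * (D.reach * D.C + D.reach + 1)) with hδ
    have e : δ * ((1 + c) * (D.reach * D.C + D.reach + 1)) = ε := div_mul_cancel₀ _ hA.ne'
    have h0 : 0 < δ := by positivity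
    have h4 : 0 ≤ δ * (D.reach * D.C) := by positivity
    have h5 : 0 ≤ δ * c * (D.reach * D.C) := by positivity
    have h6 : 0 ≤ δ * c * D.reach := by positivity
    have h7 : 0 ≤ δ * c := by positivity
    have h8 : 0 ≤ δ * D.reach := by positivity
    refine ⟨?_, ?_, ?_⟩ <;> nlinarith
  obtain ⟨s, hs, hW⟩ := D.whitney q hq δ hδ
  have hqs := mem_of_mem_nhds hs
  filter_upwards [eventually_nodes_mem hq hs, hs, D.isOpen_U.mem_nhds hqU] with P hP hPs hPU
  obtain ⟨hproj, hnode⟩ := hP hPU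
  have hg := gdist_nonneg (β := β) q P
  by_cases hΓ : P ∈ D.Γ
  · obtain ⟨h4, h5⟩ := hW P ⟨hPs, hΓ⟩ q ⟨hqs, hq⟩
    refine ⟨?_, ?_⟩
    · have := h5 P
      rw [sub_self, map_zero, gdist_self D.alternating, zero_add] at this
      rw [extension_eq_zero hPU hΓ]
      exact this.trans (by gcongr)
    · rw [jac_of_mem hΓ]
      exact h4.trans h1
  · have hh := D.height_le hPU hq
    have hh0 := D.height_nonneg P
    constructor
    · refine norm_extension_sub_affine_le hPU hΓ q fun i hi => ?_
      refine ((hW _ ⟨hnode i hi, D.node_mem i⟩ q ⟨hqs, hq⟩).2 P).trans ?_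
      have h4 := gdist_node_le_height hPU i hi
      calc δ * (gdist β (D.node i) P + gdist β q P)
          ≤ δ * (D.reach * (D.C * gdist β q P) + gdist β q P) := by
            gcongr
            exact h4.trans (by gcongr)
        _ = δ * (D.reach * D.C + 1) * gdist β q P := by ring
        _ ≤ _ := by gcongr
    · have hpm := D.proj_mem P hPU
      have h4 : ‖D.jac P - D.L (D.proj P)‖ ≤ c * (δ * (D.reach + 1)) := by
        refine ContinuousLinearMap.opNorm_le_bound _ (by positivity) fun ξ => ?_
        rw [jac_of_notMem hΓ]
        refine hc P hPU hΓ (D.proj P) (δ * (D.reach + 1)) (by positivity) (fun i hi => ?_) ξ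
        obtain ⟨h5, h6⟩ := hW _ ⟨hnode i hi, D.node_mem i⟩ _ ⟨hproj, hpm⟩
        refine ⟨h5.trans (by nlinarith), (h6 P).trans ?_⟩
        rw [mul_assoc, add_mul, one_mul]
        gcongr
        · exact gdist_node_le_height hPU i hi
        · exact le_rfl
      have h5 := (hW _ ⟨hproj, hpm⟩ q ⟨hqs, hq⟩).1
      calc ‖D.jac P - D.L q‖ = ‖(D.jac P - D.L (D.proj P)) + (D.L (D.proj P) - D.L q)‖ := by
            rw [sub_add_sub_cancel]
        _ ≤ _ := norm_add_le _ _
        _ ≤ ε := (add_le_add h4 h5).trans h3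

variable (D) in
lemma continuousOn_extension : ContinuousOn D.extension D.U := by
  intro P hP
  refine ContinuousAt.continuousWithinAt ?_
  by_cases hΓ : P ∈ D.Γ
  · have h : Tendsto (fun Q => ‖D.L P (Q.1 - P.1)‖ + 1 * gdist β P Q) (𝓝 P) (𝓝 0) := by
      have hc : Continuous fun Q : G m n => ‖D.L P (Q.1 - P.1)‖ + 1 * gdist β P Q :=
        ((D.L P).continuous.comp (continuous_fst.sub continuous_const)).norm.add
          (continuous_const.mul
            (continuous_gdist.comp (continuous_const.prodMk continuous_id)))
      simpa [gdist_self D.alternating] using hc.tendsto P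
    rw [ContinuousAt, extension_eq_zero hP hΓ]
    refine squeeze_zero_norm' ?_ h
    filter_upwards [eventually_extension hΓ hP one_pos] with Q hQ
    calc ‖D.extension Q‖ = ‖D.L P (Q.1 - P.1) + (D.extension Q - D.L P (Q.1 - P.1))‖ := by
          rw [add_sub_cancel]
      _ ≤ _ := (norm_add_le _ _).trans (add_le_add_right hQ.1 _)
  · exact (contDiffAt_extension hP hΓ).continuousAt

variable (D) in
lemma continuousOn_jac : ContinuousOn D.jac D.U := by
  intro P hP
  refine ContinuousAt.continuousWithinAt ?_
  by_cases hΓ : P ∈ D.Γ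
  · rw [Metric.continuousAt_iff']
    intro ε hε
    filter_upwards [eventually_extension hΓ hP (half_pos hε)] with Q hQ
    rw [jac_of_mem hΓ, dist_eq_norm]
    exact hQ.2.trans_lt (half_lt_self hε)
  · have h1 : ContinuousAt (fderiv ℝ D.extension) P :=
      (contDiffAt_extension hP hΓ).continuousAt_fderiv one_ne_zero
    have h2 : ContinuousAt (fun Q : G m n => (fderiv ℝ D.extension Q).comp
        ((ContinuousLinearMap.id ℝ _).prod (β Q.1))) P := by
      have h3 : Continuous fun Q : G m n => (ContinuousLinearMap.id ℝ _).prod (β Q.1) := by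
        have : (fun Q : G m n => (ContinuousLinearMap.id ℝ _).prod (β Q.1)) =
            fun Q : G m n => (ContinuousLinearMap.inl ℝ _ _) +
              (ContinuousLinearMap.inr ℝ _ _).comp (β Q.1) := by
          funext Q
          ext <;> simp
        rw [this]
        exact continuous_const.add
          (continuous_const.clm_comp (β.continuous.comp continuous_fst))
      exact h1.clm_comp h3.continuousAt
    refine h2.congr ?_
    filter_upwards [isOpen_U_diff.mem_nhds ⟨hP, hΓ⟩] with Q hQ
    rw [jac_of_notMem hQ.2]

variable (D) in
lemma extension_differentiable {P : G m n} (hP : P ∈ D.U) {ε : ℝ} (hε : 0 < ε) :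
    ∃ r > 0, ∀ Q, gdist β P Q < r →
      ‖D.extension Q - D.extension P - D.jac P (Q.1 - P.1)‖ ≤ ε * gdist β P Q := by
  by_cases hΓ : P ∈ D.Γ
  · obtain ⟨r, hr, h⟩ := exists_gdist_lt_subset D.alternating (eventually_extension hΓ hP hε)
    refine ⟨r, hr, fun Q hQ => ?_⟩
    rw [extension_eq_zero hP hΓ, sub_zero, jac_of_mem hΓ]
    exact (h Q hQ).1
  · have hf : HasFDerivAt D.extension (fderiv ℝ D.extension P) P :=
      ((contDiffAt_extension hP hΓ).differentiableAt one_ne_zero).hasFDerivAt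
    set f' := fderiv ℝ D.extension P
    set c := 1 + ‖β‖ * ‖P.1‖
    have hc : 0 < c := by positivity
    obtain ⟨r, hr, h⟩ := exists_gdist_lt_subset D.alternating
      (hf.isLittleO.def (show 0 < ε / (2 * c) by positivity))
    refine ⟨min (min r 1) (ε / (2 * (1 + ‖f'‖))), by positivity, fun Q hQ => ?_⟩
    have hr1 := hQ.trans_le (min_le_left _ _)
    have h1 := h Q (hr1.trans_le (min_le_left _ _))
    have h2 := norm_sub_le_gdist D.alternating (hr1.trans_le (min_le_right _ _)).le
    have h3 := hQ.trans_le (min_le_right _ _)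
    rw [lt_div_iff₀ (by positivity)] at h3
    have hg := gdist_nonneg (β := β) P Q
    have hy := norm_snd_sub_le_gdist_sq (β := β) P Q
    have e : D.jac P (Q.1 - P.1) = f' (Q - P) - f' (0, Q.2 - P.2 - β P.1 Q.1) := by
      rw [jac_of_notMem hΓ, ← map_sub]
      change f' (Q.1 - P.1, β P.1 (Q.1 - P.1)) = _
      congr 1
      refine Prod.ext ?_ ?_
      · simp
      · simp [map_sub, D.alternating]
    have h4 : ‖f' (0, Q.2 - P.2 - β P.1 Q.1)‖ ≤ ‖f'‖ * gdist β P Q ^ 2 := by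
      refine (f'.le_opNorm _).trans ?_
      gcongr
      rw [Prod.norm_def]
      simpa using hy
    have h5 : ε / (2 * c) * ‖Q - P‖ ≤ ε / 2 * gdist β P Q := by
      calc _ ≤ ε / (2 * c) * (c * gdist β P Q) := by gcongr
        _ = _ := by field_simp
    rw [e, sub_sub_eq_add_sub, add_sub_right_comm]
    refine (norm_add_le _ _).trans ((add_le_add (h1.trans h5) h4).trans ?_)
    nlinarith [norm_nonneg f']

end WhitneyJet

end WhitneyRegularity

section Splitting

/-- A splitting of the horizontal layer `E` into an isotropic factor `V` and a complement `Z`. -/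
structure Splitting {E Y : Type*} [NormedAddCommGroup E] [NormedSpace ℝ E]
    [NormedAddCommGroup Y] [NormedSpace ℝ Y] (β : E →L[ℝ] E →L[ℝ] Y) (V Z : Type*)
    [NormedAddCommGroup V] [NormedSpace ℝ V] [NormedAddCommGroup Z] [NormedSpace ℝ Z] where
  inH : V →L[ℝ] E
  inW : Z →L[ℝ] E
  prH : E →L[ℝ] V
  prW : E →L[ℝ] Z
  alternating : ∀ x, β x x = 0
  isotropic : ∀ v w, β (inH v) (inH w) = 0
  prH_inH : ∀ v, prH (inH v) = v
  prW_inW : ∀ a, prW (inW a) = a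
  prH_inW : ∀ a, prH (inW a) = 0
  prW_inH : ∀ v, prW (inH v) = 0
  inW_prW_add : ∀ x, inW (prW x) + inH (prH x) = x
  norm_inH : ∀ v, ‖inH v‖ = ‖v‖
  norm_inW : ∀ a, ‖inW a‖ = ‖a‖
  norm_prH_le : ∀ x, ‖prH x‖ ≤ ‖x‖
  norm_prW_le : ∀ x, ‖prW x‖ ≤ ‖x‖

namespace Splitting

variable {E Y : Type*} [NormedAddCommGroup E] [NormedSpace ℝ E]
    [NormedAddCommGroup Y] [NormedSpace ℝ Y] {β : E →L[ℝ] E →L[ℝ] Y} {V Z : Type*}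
    [NormedAddCommGroup V] [NormedSpace ℝ V] [NormedAddCommGroup Z] [NormedSpace ℝ Z]
    (S : Splitting β V Z)

/-- The product `i(A) · v` of a point of the complement and a point of the isotropic factor. -/
def point (A : Z × Y) (v : V) : E × Y :=
  (S.inW A.1 + S.inH v, A.2 + β (S.inW A.1) (S.inH v))

/-- The projection to the normal complement. -/
def coord (P : E × Y) : Z × Y :=
  (S.prW P.1, P.2 - β (S.inW (S.prW P.1)) (S.inH (S.prH P.1)))

lemma prH_point (A : Z × Y) (v : V) : S.prH (S.point A v).1 = v := by
  simp [point, S.prH_inH, S.prH_inW]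

lemma prW_point (A : Z × Y) (v : V) : S.prW (S.point A v).1 = A.1 := by
  simp [point, S.prW_inH, S.prW_inW]

lemma coord_point (A : Z × Y) (v : V) : S.coord (S.point A v) = A := by
  simp only [coord, prH_point, prW_point]
  simp [point]

lemma point_coord (P : E × Y) : S.point (S.coord P) (S.prH P.1) = P := by
  simp [coord, point, S.inW_prW_add]

lemma continuous_coord : Continuous S.coord := by
  unfold coord
  fun_prop

lemma continuous_point : Continuous fun p : (Z × Y) × V => S.point p.1 p.2 := by
  unfold point
  fun_prop

lemma gdist_point_same (A : Z × Y) (v w : V) :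
    gdist β (S.point A v) (S.point A w) = ‖w - v‖ := by
  have h : (S.point A w).2 - (S.point A v).2 - β (S.point A v).1 (S.point A w).1 = 0 := by
    simp only [point, map_add, add_apply, S.alternating, S.isotropic,
      skew_of_alternating S.alternating (S.inH v) (S.inW A.1)]
    abel
  have h' : (S.point A w).1 - (S.point A v).1 = S.inH (w - v) := by
    simp only [point, map_sub]
    abel
  rw [gdist, h, h', S.norm_inH]
  simp

lemma gdist_point_coord_le (A : Z × Y) (v : V) (P : E × Y) :
    gdist β (S.point A v) (S.point (S.coord P) v) ≤
      2 * (1 + ‖β‖) * gdist β (S.point A v) P := by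
  have h1 := gdist_triangle S.alternating (S.point A v) P (S.point (S.coord P) v)
  have h2 : gdist β P (S.point (S.coord P) v) = ‖v - S.prH P.1‖ := by
    conv_lhs => rw [← S.point_coord P]
    rw [S.coord_point, S.gdist_point_same]
  have h3 : ‖v - S.prH P.1‖ ≤ gdist β (S.point A v) P := by
    rw [norm_sub_rev]
    calc ‖S.prH P.1 - v‖ = ‖S.prH (P.1 - (S.point A v).1)‖ := by rw [map_sub, S.prH_point]
      _ ≤ ‖P.1 - (S.point A v).1‖ := S.norm_prH_le _
      _ ≤ _ := norm_fst_sub_le_gdist _ _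
  rw [h2] at h1
  have := norm_nonneg β
  nlinarith

/-- The horizontal curve through `i(A) · v` in direction `ζ`, seen in the complement. -/
def ray (A : Z × Y) (v : V) (ζ : Z) (t : ℝ) : Z × Y :=
  (A.1 + t • ζ, A.2 + t • (β (S.inW A.1) (S.inW ζ) - (2 : ℝ) • β (S.inW ζ) (S.inH v)))

lemma gdist_point_ray (A : Z × Y) (v : V) (ζ : Z) {t : ℝ} (ht : 0 ≤ t) :
    gdist β (S.point A v) (S.point (S.ray A v ζ t) v) = t * ‖ζ‖ := by
  have h : (S.point (S.ray A v ζ t) v).2 - (S.point A v).2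
      - β (S.point A v).1 (S.point (S.ray A v ζ t) v).1 = 0 := by
    simp only [point, ray, map_add, map_smul, add_apply, smul_apply, S.alternating,
      skew_of_alternating S.alternating (S.inH v) (S.inW A.1),
      skew_of_alternating S.alternating (S.inH v) (S.inW ζ)]
    module
  have h' : (S.point (S.ray A v ζ t) v).1 - (S.point A v).1 = t • S.inW ζ := by
    simp only [point, ray, map_add, map_smul]
    abel
  rw [gdist, h, h', norm_smul, S.norm_inW, Real.norm_of_nonneg ht]
  simpa using by positivity

/-- Uniform intrinsic differentiability of `φ` at `A` with differential `M`. -/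
def UnifDiffAt (φ : Z × Y → V) (M : Z →L[ℝ] V) (A : Z × Y) : Prop :=
  ∀ ε > 0, ∀ᶠ p in 𝓝 A ×ˢ 𝓝 A, ‖φ p.2 - φ p.1 - M (p.2.1 - p.1.1)‖ ≤
    ε * gdist β (S.point p.1 (φ p.1)) (S.point p.2 (φ p.1))

variable {S} {φ : Z × Y → V} {M : Z →L[ℝ] V} {A : Z × Y}

lemma UnifDiffAt.exists_isOpen (h : S.UnifDiffAt φ M A) {ε : ℝ} (hε : 0 < ε) :
    ∃ N, IsOpen N ∧ A ∈ N ∧ ∀ A₁ ∈ N, ∀ A₂ ∈ N, ‖φ A₂ - φ A₁ - M (A₂.1 - A₁.1)‖ ≤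
      ε * gdist β (S.point A₁ (φ A₁)) (S.point A₂ (φ A₁)) := by
  obtain ⟨t, ht, H⟩ := eventually_prod_self_iff'.1 (h ε hε)
  obtain ⟨N, hN, hNo, hA⟩ := mem_nhds_iff.1 ht
  exact ⟨N, hNo, hA, fun A₁ h₁ A₂ h₂ => H A₁ (hN h₁) A₂ (hN h₂)⟩

lemma UnifDiffAt.norm_sub_le (h : S.UnifDiffAt φ M A) {ε : ℝ} (hε : 0 < ε) :
    ∀ᶠ A' in 𝓝 A, ∀ M', S.UnifDiffAt φ M' A' → ‖M' - M‖ ≤ ε := by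
  obtain ⟨N, hN, hA, H⟩ := h.exists_isOpen (half_pos hε)
  filter_upwards [hN.mem_nhds hA] with A' hA' M' h'
  refine ContinuousLinearMap.opNorm_le_bound _ hε.le fun ζ => ?_
  obtain ⟨N', hN', hA'', H'⟩ := h'.exists_isOpen (half_pos hε)
  have hc : Tendsto (S.ray A' (φ A') ζ) (𝓝[>] 0) (𝓝 A') := by
    have : Continuous (S.ray A' (φ A') ζ) := by
      unfold ray
      fun_prop
    have h0 := this.tendsto 0
    rw [show S.ray A' (φ A') ζ 0 = A' by simp [ray]] at h0
    exact h0.mono_left nhdsWithin_le_nhds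
  obtain ⟨t, ⟨ht1, ht2⟩, ht0⟩ := ((hc.eventually (inter_mem (hN.mem_nhds hA')
    (hN'.mem_nhds hA''))).and self_mem_nhdsWithin).exists
  have ht0 : 0 < t := ht0
  have h1 := H A' hA' _ ht1
  have h2 := H' A' hA'' _ ht2
  rw [S.gdist_point_ray _ _ _ ht0.le] at h1 h2
  have e : (S.ray A' (φ A') ζ t).1 - A'.1 = t • ζ := by simp [ray]
  rw [e] at h1 h2
  have h3 : t * ‖(M' - M) ζ‖ ≤ t * (ε * ‖ζ‖) := by
    calc t * ‖(M' - M) ζ‖ = ‖t • (M' - M) ζ‖ := by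
          rw [norm_smul, Real.norm_of_nonneg ht0.le]
      _ = ‖(φ (S.ray A' (φ A') ζ t) - φ A' - M (t • ζ))
          - (φ (S.ray A' (φ A') ζ t) - φ A' - M' (t • ζ))‖ := by
          congr 1
          simp only [map_smul, sub_apply, smul_sub]
          abel
      _ ≤ ε / 2 * (t * ‖ζ‖) + ε / 2 * (t * ‖ζ‖) :=
          (_root_.norm_sub_le _ _).trans (add_le_add h1 h2)
      _ = _ := by ring
  exact le_of_mul_le_mul_left h3 ht0

lemma UnifDiffAt.continuousAt (h : S.UnifDiffAt φ M A) : ContinuousAt φ A := by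
  obtain ⟨N, hN, hA, H⟩ := h.exists_isOpen one_pos
  have hb : Tendsto (fun B : Z × Y => ‖M (B.1 - A.1)‖ +
      1 * gdist β (S.point A (φ A)) (S.point B (φ A))) (𝓝 A) (𝓝 0) := by
    have : Continuous (fun B : Z × Y => ‖M (B.1 - A.1)‖ +
        1 * gdist β (S.point A (φ A)) (S.point B (φ A))) := by
      have h1 : Continuous fun B : Z × Y => gdist β (S.point A (φ A)) (S.point B (φ A)) :=
        continuous_gdist.comp (continuous_const.prodMk
          (S.continuous_point.comp (continuous_id.prodMk continuous_const)))
      fun_prop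
    simpa [gdist_self S.alternating] using this.tendsto A
  refine tendsto_iff_norm_sub_tendsto_zero.2 (squeeze_zero' (.of_forall fun _ => norm_nonneg _)
    ?_ hb)
  filter_upwards [hN.mem_nhds hA] with B hB
  calc ‖φ B - φ A‖ = ‖M (B.1 - A.1) + (φ B - φ A - M (B.1 - A.1))‖ := by congr 1; abel
    _ ≤ _ := (norm_add_le _ _).trans (add_le_add le_rfl (H A hA B hB))

end Splitting

end Splitting

section DefiningFunction

namespace Splitting

variable {m n : ℕ} {β : (Fin m → ℝ) →L[ℝ] (Fin m → ℝ) →L[ℝ] (Fin n → ℝ)} {V Z : Type*}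
    [NormedAddCommGroup V] [NormedSpace ℝ V] [NormedAddCommGroup Z] [NormedSpace ℝ Z]
    (S : Splitting β V Z) {φ : Z × (Fin n → ℝ) → V} {M : Z × (Fin n → ℝ) → Z →L[ℝ] V}
    {K : Set (Z × (Fin n → ℝ))}

/-- The Whitney jet on the intrinsic graph of a uniformly intrinsically differentiable map which
is intrinsically Lipschitz on `K`. -/
def graphJet (hK : IsOpen K) (hM : ∀ A ∈ K, S.UnifDiffAt φ (M A) A) {Λ : ℝ} (hΛ : 0 ≤ Λ)
    (hφ : ∀ A ∈ K, ∀ B ∈ K,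
      ‖φ B - φ A‖ ≤ Λ * gdist β (S.point A (φ A)) (S.point B (φ A))) : WhitneyJet β V where
  alternating := S.alternating
  Γ := {P | S.coord P ∈ K ∧ S.prH P.1 = φ (S.coord P)}
  U := S.coord ⁻¹' K
  isOpen_U := hK.preimage S.continuous_coord
  proj P := S.point (S.coord P) (φ (S.coord P))
  L P := S.prH - (M (S.coord P)).comp S.prW
  C := 1 + Λ * (2 * (1 + ‖β‖))
  one_le_C := le_add_of_nonneg_right (by positivity)
  proj_mem P hP := by
    refine ⟨?_, ?_⟩
    · rw [S.coord_point]
      exact hP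
    · rw [S.coord_point, S.prH_point]
  gdist_proj_le P hP q hq := by
    obtain ⟨hq1, hq2⟩ := hq
    have h1 := hφ _ hq1 _ hP
    have h2 := S.gdist_point_coord_le (S.coord q) (φ (S.coord q)) P
    have h3 : S.point (S.coord q) (φ (S.coord q)) = q := by rw [← hq2, S.point_coord]
    rw [h3] at h1 h2
    have h4 : gdist β (S.point (S.coord P) (φ (S.coord P))) P = ‖S.prH P.1 - φ (S.coord P)‖ := by
      conv_lhs => rw [← S.point_coord P]
      rw [S.coord_point, S.gdist_point_same]
    rw [h4]
    calc ‖S.prH P.1 - φ (S.coord P)‖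
        = ‖S.prH (P.1 - q.1) - (φ (S.coord P) - φ (S.coord q))‖ := by
          rw [map_sub, hq2]
          congr 1
          abel
      _ ≤ gdist β q P + Λ * (2 * (1 + ‖β‖) * gdist β q P) := by
          refine (norm_sub_le _ _).trans (add_le_add ?_ (h1.trans (by gcongr)))
          exact (S.norm_prH_le _).trans (norm_fst_sub_le_gdist _ _)
      _ = _ := by ring
  whitney q₀ hq₀ ε hε := by
    have hb := norm_nonneg β
    set c := 2 * (1 + ‖β‖) * (1 + ‖β‖) with hc
    have hc0 : 0 < c := by positivity
    have hδ : 0 < ε / (2 + c) := by positivity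
    have hδε : ε / (2 + c) * (2 + c) = ε := by field_simp
    set δ := ε / (2 + c)
    obtain ⟨N, hN, hA, H⟩ := (hM _ hq₀.1).exists_isOpen hδ
    have hnear := (hM _ hq₀.1).norm_sub_le hδ
    refine ⟨_, S.continuous_coord.continuousAt.preimage_mem_nhds
      (inter_mem (hN.mem_nhds hA) hnear), ?_⟩
    rintro q₁ ⟨⟨h1N, h1M⟩, h1K, h1⟩ q₂ ⟨⟨h2N, h2M⟩, h2K, h2⟩
    have d1 := h1M _ (hM _ h1K)
    have d2 := h2M _ (hM _ h2K)
    set A₁ := S.coord q₁ with hA₁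
    set A₂ := S.coord q₂ with hA₂
    set M₀ := M (S.coord q₀)
    refine ⟨?_, fun P => ?_⟩
    · refine ContinuousLinearMap.opNorm_le_bound _ hε.le fun x => ?_
      have e : (S.prH - (M A₁).comp S.prW - (S.prH - (M A₂).comp S.prW)) x
          = (M A₂ - M₀) (S.prW x) - (M A₁ - M₀) (S.prW x) := by
        simp only [sub_apply, ContinuousLinearMap.comp_apply]
        abel
      have hx := S.norm_prW_le x
      have hx0 := norm_nonneg x
      rw [e]
      calc _ ≤ δ * ‖x‖ + δ * ‖x‖ := (norm_sub_le _ _).trans (add_le_add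
            ((M A₂ - M₀).le_of_opNorm_le_of_le d2 hx) ((M A₁ - M₀).le_of_opNorm_le_of_le d1 hx))
        _ ≤ ε * ‖x‖ := by
            rw [← hδε]
            nlinarith [mul_nonneg (mul_nonneg hδ.le hx0) hc0.le]
    · have hg1 := gdist_nonneg (β := β) q₁ P
      have hg2 := gdist_nonneg (β := β) q₂ P
      have e : (S.prH - (M A₁).comp S.prW) (P.1 - q₁.1) - (S.prH - (M A₂).comp S.prW) (P.1 - q₂.1)
          = (φ A₂ - φ A₁ - M₀ (A₂.1 - A₁.1)) - (M A₁ - M₀) (S.prW (P.1 - q₁.1))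
            + (M A₂ - M₀) (S.prW (P.1 - q₂.1)) := by
        rw [← h1, ← h2]
        simp only [hA₁, hA₂, coord, sub_apply, ContinuousLinearMap.comp_apply, map_sub]
        abel
      have h3 : S.point A₁ (φ A₁) = q₁ := by rw [← h1, S.point_coord]
      have k1 := H _ h1N _ h2N
      have k2 := S.gdist_point_coord_le A₁ (φ A₁) q₂
      have k3 := gdist_triangle S.alternating q₁ P q₂
      rw [gdist_comm S.alternating P q₂] at k3
      rw [h3] at k1 k2
      have k4 : gdist β q₁ (S.point A₂ (φ A₁)) ≤ c * (gdist β q₁ P + gdist β q₂ P) := by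
        refine k2.trans ?_
        rw [hc, mul_assoc (2 * (1 + ‖β‖))]
        gcongr
      rw [e]
      calc _ ≤ δ * (c * (gdist β q₁ P + gdist β q₂ P)) + δ * gdist β q₁ P + δ * gdist β q₂ P := by
            refine (norm_add_le _ _).trans (add_le_add ((norm_sub_le _ _).trans (add_le_add
              (k1.trans (by gcongr)) ?_)) ?_)
            · exact (M A₁ - M₀).le_of_opNorm_le_of_le d1
                ((S.norm_prW_le _).trans (norm_fst_sub_le_gdist _ _))
            · exact (M A₂ - M₀).le_of_opNorm_le_of_le d2
                ((S.norm_prW_le _).trans (norm_fst_sub_le_gdist _ _))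
        _ ≤ ε * (gdist β q₁ P + gdist β q₂ P) := by
            rw [← hδε]
            nlinarith [mul_nonneg hδ.le hg1, mul_nonneg hδ.le hg2]

variable {S}

lemma exists_intrinsicLipschitz (hK : IsOpen K) (hM : ∀ A ∈ K, S.UnifDiffAt φ (M A) A)
    {A₀ : Z × (Fin n → ℝ)} (hA₀ : A₀ ∈ K) :
    ∃ K' ⊆ K, IsOpen K' ∧ A₀ ∈ K' ∧ ∃ Λ, 0 ≤ Λ ∧ ∀ A ∈ K', ∀ B ∈ K',
      ‖φ B - φ A‖ ≤ Λ * gdist β (S.point A (φ A)) (S.point B (φ A)) := by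
  obtain ⟨N, hN, hA, H⟩ := (hM _ hA₀).exists_isOpen one_pos
  refine ⟨N ∩ K, inter_subset_right, hN.inter hK, ⟨hA, hA₀⟩, ‖M A₀‖ + 1, by positivity,
    fun A hA B hB => ?_⟩
  have h1 : ‖B.1 - A.1‖ ≤ gdist β (S.point A (φ A)) (S.point B (φ A)) := by
    refine le_trans (le_of_eq ?_) (norm_fst_sub_le_gdist _ _)
    rw [← S.norm_inW]
    congr 1
    simp only [point, map_sub]
    abel
  calc ‖φ B - φ A‖ = ‖M A₀ (B.1 - A.1) + (φ B - φ A - M A₀ (B.1 - A.1))‖ := by congr 1; abel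
    _ ≤ _ := (norm_add_le _ _).trans (add_le_add ((M A₀).le_opNorm_of_le h1) (H A hA.1 B hB.1))
    _ = _ := by ring

/-- The intrinsic graph of a uniformly intrinsically differentiable map is locally the zero set of
a function with continuous horizontal derivative which is close to the identity on the isotropic
factor. -/
theorem exists_defining_function {O : Set (Z × (Fin n → ℝ))} (hO : IsOpen O)
    (hM : ∀ A ∈ O, S.UnifDiffAt φ (M A) A) {A₀ : Z × (Fin n → ℝ)} (hA₀ : A₀ ∈ O) :
    ∃ (f : G m n → V) (J : G m n → (Fin m → ℝ) →L[ℝ] V) (Ω : Set (G m n)),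
      IsOpen Ω ∧ S.point A₀ (φ A₀) ∈ Ω ∧ ContinuousOn f Ω ∧ ContinuousOn J Ω ∧
      (∀ P ∈ Ω, ∀ ε > 0, ∃ r > 0, ∀ Q, gdist β P Q < r →
        ‖f Q - f P - J P (Q.1 - P.1)‖ ≤ ε * gdist β P Q) ∧
      (∀ P ∈ Ω, (P ∈ (fun A => S.point A (φ A)) '' O ↔ f P = 0)) ∧
      ∀ P ∈ Ω, ∀ v, ‖J P (S.inH v) - v‖ ≤ 1 / 2 * ‖v‖ := by
  obtain ⟨K, hKO, hK, hAK, Λ, hΛ, hLip⟩ := exists_intrinsicLipschitz hO hM hA₀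
  set D := S.graphJet hK (fun A hA => hM A (hKO hA)) hΛ hLip with hD
  have hDU : ∀ {P}, P ∈ D.U ↔ S.coord P ∈ K := Iff.rfl
  have hDΓ : ∀ {P}, P ∈ D.Γ ↔ S.coord P ∈ K ∧ S.prH P.1 = φ (S.coord P) := Iff.rfl
  have hΓ : ∀ A ∈ K, S.point A (φ A) ∈ D.Γ := fun A hA => by
    rw [hDΓ, S.coord_point, S.prH_point]
    exact ⟨hA, rfl⟩
  set P₀ := S.point A₀ (φ A₀) with hP₀
  have hP₀U : P₀ ∈ D.U := by rwa [hDU, S.coord_point]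
  have hJ₀ : (D.jac P₀).comp S.inH = ContinuousLinearMap.id ℝ V := by
    rw [WhitneyJet.jac_of_mem (hΓ _ hAK)]
    ext v
    simp [hD, graphJet, S.prH_inH, S.prW_inH]
  have hJnear : ∀ᶠ P in 𝓝 P₀, ‖(D.jac P).comp S.inH - ContinuousLinearMap.id ℝ V‖ < 1 / 2 := by
    have hc : ContinuousAt D.jac P₀ := D.continuousOn_jac.continuousAt (D.isOpen_U.mem_nhds hP₀U)
    have : ContinuousAt (fun P => ‖(D.jac P).comp S.inH - ContinuousLinearMap.id ℝ V‖) P₀ :=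
      ((hc.clm_comp continuousAt_const).sub continuousAt_const).norm
    refine this.eventually_lt continuousAt_const ?_
    simp [hJ₀]
  have hpt : Tendsto (fun p : (Z × (Fin n → ℝ)) × V => S.point p.1 p.2)
      (𝓝 A₀ ×ˢ 𝓝 (φ A₀)) (𝓝 P₀) := by
    rw [← nhds_prod_eq]
    exact S.continuous_point.tendsto (A₀, φ A₀)
  obtain ⟨u, hu, w, hw, huw⟩ := eventually_prod_iff.1 (hpt.eventually hJnear)
  obtain ⟨ρ, hρ, hρw⟩ := Metric.eventually_nhds_iff_ball.1 hw
  have hφ : ContinuousAt φ A₀ := (hM _ hA₀).continuousAt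
  obtain ⟨N, hNs, hN, hAN⟩ := mem_nhds_iff.1 (inter_mem (inter_mem (hK.mem_nhds hAK) hu)
    (hφ.preimage_mem_nhds (Metric.ball_mem_nhds _ hρ)))
  have hsub : ∀ A ∈ N, ∀ v ∈ Metric.ball (φ A₀) ρ,
      ‖(D.jac (S.point A v)).comp S.inH - ContinuousLinearMap.id ℝ V‖ ≤ 1 / 2 :=
    fun A hA v hv => (huw (hNs hA).1.2 (hρw v hv)).le
  set Ω : Set (G m n) := {P | S.coord P ∈ N ∧ S.prH P.1 ∈ Metric.ball (φ A₀) ρ} with hΩ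
  have hΩU : Ω ⊆ D.U := fun P hP => (hNs hP.1).1.1
  refine ⟨D.extension, D.jac, Ω, ?_, ?_, D.continuousOn_extension.mono hΩU,
    D.continuousOn_jac.mono hΩU, fun P hP ε hε => D.extension_differentiable (hΩU hP) hε,
    fun P hP => ⟨?_, fun h0 => ?_⟩, fun P hP v => ?_⟩
  · exact (hN.preimage S.continuous_coord).inter
      (Metric.isOpen_ball.preimage (S.prH.continuous.comp continuous_fst))
  · refine ⟨?_, ?_⟩
    · rwa [S.coord_point]
    · rw [S.prH_point]
      exact Metric.mem_ball_self hρ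
  · rintro ⟨A, -, rfl⟩
    have hA : A ∈ K := by simpa [S.coord_point] using (hNs hP.1).1.1
    exact WhitneyJet.extension_eq_zero (hΩU hP) (hΓ A hA)
  · set A := S.coord P with hA
    have hAK : A ∈ K := (hNs hP.1).1.1
    have hpU : ∀ v, S.point A v ∈ D.U := fun v => by rwa [hDU, S.coord_point]
    have hder : ∀ v, HasFDerivAt (fun v => D.extension (S.point A v))
        ((D.jac (S.point A v)).comp S.inH) v := fun v => by
      refine HasFDerivAt.of_isLittleO (Asymptotics.isLittleO_iff.2 fun ε hε => ?_)
      obtain ⟨r, hr, H⟩ := D.extension_differentiable (hpU v) hε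
      filter_upwards [Metric.ball_mem_nhds v hr] with v' hv'
      have h1 := H (S.point A v')
      rw [S.gdist_point_same] at h1
      have h2 := h1 (by rwa [mem_ball_iff_norm] at hv')
      simpa [point] using h2
    have hmv := (convex_ball (φ A₀) ρ).norm_image_sub_le_of_norm_hasFDerivWithin_le'
      (fun v _ => (hder v).hasFDerivWithinAt) (hsub A hP.1) (hNs hP.1).2 hP.2
    have h1 : D.extension (S.point A (φ A)) = 0 :=
      WhitneyJet.extension_eq_zero (hpU _) (hΓ A hAK)
    rw [S.point_coord P, h0, h1, sub_self, zero_sub, norm_neg] at hmv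
    have h2 : ‖S.prH P.1 - φ A‖ ≤ 1 / 2 * ‖S.prH P.1 - φ A‖ := hmv
    have h3 : S.prH P.1 = φ A := by
      refine sub_eq_zero.1 (norm_eq_zero.1 (le_antisymm ?_ (norm_nonneg _)))
      linarith
    refine ⟨A, hKO hAK, ?_⟩
    change S.point A (φ A) = P
    rw [← h3, S.point_coord]
  · have h1 := hsub _ hP.1 _ hP.2
    rw [S.point_coord] at h1
    simpa using (((D.jac P).comp S.inH) - ContinuousLinearMap.id ℝ V).le_of_opNorm_le h1 v

end Splitting

end DefiningFunction

section Coordinates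

lemma norm_le_enorm {d : ℕ} (x : Fin d → ℝ) : ‖x‖ ≤ enorm x := by
  refine (pi_norm_le_iff_of_nonneg (Real.sqrt_nonneg _)).2 fun i => ?_
  rw [Real.norm_eq_abs, ← Real.sqrt_sq_eq_abs]
  exact Real.sqrt_le_sqrt
    (Finset.single_le_sum (f := fun i => x i ^ 2) (fun j _ => sq_nonneg _) (Finset.mem_univ i))

lemma enorm_le_mul_norm {d : ℕ} (x : Fin d → ℝ) : enorm x ≤ d * ‖x‖ := by
  refine Real.sqrt_le_iff.2 ⟨by positivity, ?_⟩
  have h : ∑ i, x i ^ 2 ≤ d * ‖x‖ ^ 2 := by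
    have := Finset.sum_le_card_nsmul Finset.univ (fun i => x i ^ 2) (‖x‖ ^ 2) fun i _ => by
      rw [← sq_abs, ← Real.norm_eq_abs]
      gcongr
      exact norm_le_pi_norm x i
    simpa using this
  have h' : (d : ℝ) ≤ d ^ 2 := by exact_mod_cast Nat.le_self_pow two_ne_zero d
  rw [mul_pow]
  exact h.trans (by gcongr)

variable {m n : ℕ} (b : Fin n → Matrix (Fin m) (Fin m) ℝ)

/-- The bilinear form `(x, x') ↦ ½⟨Bx, x'⟩`. -/
def bracket : (Fin m → ℝ) →L[ℝ] (Fin m → ℝ) →L[ℝ] (Fin n → ℝ) :=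
  LinearMap.toContinuousBilinearMap <|
    LinearMap.mk₂ ℝ (fun x x' s => (1 / 2) * ∑ i, ∑ j, b s i j * x j * x' i)
      (fun x y z => by
        ext s
        simp only [Pi.add_apply, mul_add, add_mul, Finset.sum_add_distrib])
      (fun c x y => by
        ext s
        simp only [Pi.smul_apply, smul_eq_mul, Finset.mul_sum]
        exact Finset.sum_congr rfl fun i _ => Finset.sum_congr rfl fun j _ => by ring)
      (fun x y z => by
        ext s
        simp only [Pi.add_apply, mul_add, Finset.sum_add_distrib])
      (fun c x y => by
        ext s
        simp only [Pi.smul_apply, smul_eq_mul, Finset.mul_sum]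
        exact Finset.sum_congr rfl fun i _ => Finset.sum_congr rfl fun j _ => by ring)

lemma bracket_apply (x x' : Fin m → ℝ) (s : Fin n) :
    bracket b x x' s = (1 / 2) * ∑ i, ∑ j, b s i j * x j * x' i := rfl

lemma gmul_eq (P Q : G m n) : gmul b P Q = (P.1 + Q.1, P.2 + Q.2 + bracket b P.1 Q.1) := rfl

lemma ginv_gmul_eq (P Q : G m n) :
    gmul b (ginv P) Q = (Q.1 - P.1, Q.2 - P.2 - bracket b P.1 Q.1) := by
  simp only [gmul_eq, ginv, map_neg, neg_apply]
  refine Prod.ext (neg_add_eq_sub _ _) ?_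
  dsimp only
  abel

variable {b}

lemma bracket_self (hskew : ∀ s, (b s).transpose = -(b s)) (x : Fin m → ℝ) :
    bracket b x x = 0 := by
  ext s
  have h : ∑ i, ∑ j, b s i j * x j * x i = -∑ i, ∑ j, b s i j * x j * x i := by
    conv_lhs => rw [Finset.sum_comm]
    rw [← Finset.sum_neg_distrib]
    refine Finset.sum_congr rfl fun i _ => ?_
    rw [← Finset.sum_neg_distrib]
    refine Finset.sum_congr rfl fun j _ => ?_
    have : b s j i = -b s i j := congrFun (congrFun (hskew s) i) j
    rw [this]
    ring
  rw [bracket_apply, Pi.zero_apply]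
  linarith

lemma gdist_le_qnorm (P Q : G m n) : gdist (bracket b) P Q ≤ qnorm (gmul b (ginv P) Q) := by
  rw [ginv_gmul_eq, qnorm]
  refine max_le ?_ ?_
  · exact (norm_le_enorm _).trans (le_add_of_nonneg_right (Real.sqrt_nonneg _))
  · exact (Real.sqrt_le_sqrt (norm_le_enorm _)).trans (le_add_of_nonneg_left (Real.sqrt_nonneg _))

lemma qnorm_le_mul_gdist (P Q : G m n) :
    qnorm (gmul b (ginv P) Q) ≤ (m + n) * gdist (bracket b) P Q := by
  have h0 := gdist_nonneg (β := bracket b) P Q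
  rw [ginv_gmul_eq, qnorm, add_mul]
  refine add_le_add ((enorm_le_mul_norm _).trans ?_) (Real.sqrt_le_iff.2 ⟨by positivity, ?_⟩)
  · gcongr
    exact norm_fst_sub_le_gdist _ _
  · refine (enorm_le_mul_norm _).trans ?_
    have h' : (n : ℝ) ≤ n ^ 2 := by exact_mod_cast Nat.le_self_pow two_ne_zero n
    rw [mul_pow]
    gcongr
    exact norm_snd_sub_le_gdist_sq _ _

/-- The inclusion of the last `m - k` coordinates into `ℝ^m`. -/
def inclLast (m k : ℕ) : (Fin (m - k) → ℝ) →L[ℝ] (Fin m → ℝ) :=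
  ContinuousLinearMap.pi fun j => if h : (j : ℕ) < k then 0 else
    ContinuousLinearMap.proj ⟨(j : ℕ) - k, by have := j.isLt; omega⟩

/-- The restriction to the last `m - k` coordinates of `ℝ^m`. -/
def restrLast (m k : ℕ) : (Fin m → ℝ) →L[ℝ] (Fin (m - k) → ℝ) :=
  ContinuousLinearMap.pi fun i =>
    ContinuousLinearMap.proj ⟨k + (i : ℕ), by have := i.isLt; omega⟩

/-- The splitting of `ℝ^m` into the first `k` and the last `m - k` coordinates. -/
def coordSplitting {k : ℕ} (hk : k ≤ m) (hskew : ∀ s, (b s).transpose = -(b s))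
    (hblock : ∀ s (i j : Fin m), (i : ℕ) < k → (j : ℕ) < k → b s i j = 0) :
    Splitting (bracket b) (Fin k → ℝ) (Fin (m - k) → ℝ) where
  inH := ContinuousLinearMap.pi fun j => if h : (j : ℕ) < k then
    ContinuousLinearMap.proj ⟨j, h⟩ else 0
  inW := inclLast m k
  prH := ContinuousLinearMap.pi fun i => ContinuousLinearMap.proj (Fin.castLE hk i)
  prW := restrLast m k
  alternating := bracket_self hskew
  isotropic v w := by
    ext s
    rw [bracket_apply, Finset.sum_eq_zero, mul_zero, Pi.zero_apply]
    intro i _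
    refine Finset.sum_eq_zero fun j _ => ?_
    by_cases hi : (i : ℕ) < k
    · by_cases hj : (j : ℕ) < k
      · simp [hblock s i j hi hj]
      · simp [hj]
    · simp [hi]
  prH_inH v := by
    ext i
    simp
  prW_inW a := by
    ext i
    simp [inclLast, restrLast]
  prH_inW a := by
    ext i
    simp [inclLast]
  prW_inH v := by
    ext i
    simp [restrLast]
  inW_prW_add x := by
    ext j
    by_cases h : (j : ℕ) < k
    · simp [h, inclLast]
    · simp [h, inclLast, restrLast, Nat.add_sub_cancel' (not_lt.1 h)]
  norm_inH v := by
    refine le_antisymm ((pi_norm_le_iff_of_nonneg (norm_nonneg _)).2 fun j => ?_)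
      ((pi_norm_le_iff_of_nonneg (norm_nonneg _)).2 fun i => ?_)
    · by_cases h : (j : ℕ) < k
      · simpa [h] using norm_le_pi_norm v ⟨j, h⟩
      · simp [h]
    · refine le_trans (le_of_eq ?_) (norm_le_pi_norm _ (Fin.castLE hk i))
      simp
  norm_inW a := by
    refine le_antisymm ((pi_norm_le_iff_of_nonneg (norm_nonneg _)).2 fun j => ?_)
      ((pi_norm_le_iff_of_nonneg (norm_nonneg _)).2 fun i => ?_)
    · by_cases h : (j : ℕ) < k
      · simp [h, inclLast]
      · simpa [h, inclLast] using norm_le_pi_norm a ⟨(j : ℕ) - k, by have := j.isLt; omega⟩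
    · refine le_trans (le_of_eq ?_)
        (norm_le_pi_norm _ (⟨k + (i : ℕ), by have := i.isLt; omega⟩ : Fin m))
      simp [inclLast]
  norm_prH_le x := (pi_norm_le_iff_of_nonneg (norm_nonneg _)).2 fun i => norm_le_pi_norm x _
  norm_prW_le x := (pi_norm_le_iff_of_nonneg (norm_nonneg _)).2 fun i => norm_le_pi_norm x _

section

variable {k : ℕ} {hk : k ≤ m} {hskew : ∀ s, (b s).transpose = -(b s)}
  {hblock : ∀ s (i j : Fin m), (i : ℕ) < k → (j : ℕ) < k → b s i j = 0}

lemma coordSplitting_embH (v : Fin k → ℝ) :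
    embH m n k v = ((coordSplitting hk hskew hblock).inH v, 0) := by
  refine Prod.ext (funext fun j => ?_) rfl
  by_cases h : (j : ℕ) < k <;> simp [embH, coordSplitting, h]

lemma coordSplitting_embW (A : W m n k) :
    embW m n k A = ((coordSplitting hk hskew hblock).inW A.1, A.2) := by
  refine Prod.ext (funext fun j => ?_) rfl
  by_cases h : (j : ℕ) < k <;> simp [embW, coordSplitting, inclLast, h]

lemma coordSplitting_point (A : W m n k) (v : Fin k → ℝ) :
    (coordSplitting hk hskew hblock).point A v = gmul b (embW m n k A) (embH m n k v) := by
  rw [coordSplitting_embH (hk := hk) (hskew := hskew) (hblock := hblock),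
    coordSplitting_embW (hk := hk) (hskew := hskew) (hblock := hblock), gmul_eq]
  simp [Splitting.point]

lemma coordSplitting_point_zero (A : W m n k) :
    (coordSplitting hk hskew hblock).point A 0 = embW m n k A := by
  rw [coordSplitting_embW (hk := hk) (hskew := hskew) (hblock := hblock)]
  simp [Splitting.point]

lemma sigma_eq (hskew : ∀ s, (b s).transpose = -(b s)) (φ : W m n k → Fin k → ℝ) (A B : W m n k) :
    sigma m n k b φ A B = qnorm (gmul b (ginv (gmul b (embW m n k A) (embH m n k (φ A))))
      (gmul b (embW m n k B) (embH m n k (φ A)))) := by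
  have hs := skew_of_alternating (bracket_self hskew)
  rw [sigma]
  congr 1
  simp only [gmul_eq, ginv]
  refine Prod.ext (by simp only; abel) ?_
  simp only [map_add, map_neg, add_apply, neg_apply, bracket_self hskew,
    hs (embH m n k (φ A)).1 (embW m n k A).1]
  abel

lemma coordSplitting_unifDiffAt (hn : 1 ≤ n) {O : Set (W m n k)} (hO : IsOpen O)
    {φ : W m n k → Fin k → ℝ} {A : W m n k} (hA : A ∈ O) {M : Matrix (Fin k) (Fin (m - k)) ℝ}
    (h : UID m n k b O φ A M) :
    (coordSplitting hk hskew hblock).UnifDiffAt φ M.mulVecLin.toContinuousLinearMap A := by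
  set S := coordSplitting hk hskew hblock
  intro ε hε
  have hmn : (0 : ℝ) < m + n := by
    have : (1 : ℝ) ≤ n := by exact_mod_cast hn
    positivity
  obtain ⟨r, hr, H⟩ := h (ε / (m + n)) (by positivity)
  have hdW : ∀ A B : W m n k, dW m n k b A B ≤ (m + n) * gdist (bracket b) (S.point A 0)
      (S.point B 0) := fun A B => by
    rw [coordSplitting_point_zero, coordSplitting_point_zero]
    exact qnorm_le_mul_gdist _ _
  have hpt : Continuous fun A => S.point A 0 :=
    S.continuous_point.comp (continuous_id.prodMk continuous_const)
  have c1 : Continuous fun p : W m n k × W m n k => (m + n) * gdist (bracket b) (S.point A 0)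
      (S.point p.1 0) :=
    continuous_const.mul
      (continuous_gdist.comp (continuous_const.prodMk (hpt.comp continuous_fst)))
  have c2 : Continuous fun p : W m n k × W m n k => (m + n) * gdist (bracket b) (S.point p.1 0)
      (S.point p.2 0) :=
    continuous_const.mul
      (continuous_gdist.comp ((hpt.comp continuous_fst).prodMk (hpt.comp continuous_snd)))
  have e1 := (c1.tendsto (A, A)).eventually_lt_const (u := r)
    (by simpa [gdist_self S.alternating] using hr)
  have e2 := (c2.tendsto (A, A)).eventually_lt_const (u := r)
    (by simpa [gdist_self S.alternating] using hr)
  rw [nhds_prod_eq] at e1 e2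
  filter_upwards [e1, e2, prod_mem_prod (hO.mem_nhds hA) (hO.mem_nhds hA)]
  rintro ⟨A₁, A₂⟩ h1 h2 ⟨hA₁, hA₂⟩
  dsimp only at h1 h2 hA₁ hA₂ ⊢
  by_cases h0 : 0 < dW m n k b A₁ A₂
  · have h3 := H A₁ hA₁ A₂ hA₂ ((hdW _ _).trans_lt h1) ((hdW _ _).trans_lt h2) h0
    refine (norm_le_enorm _).trans (h3.trans ?_)
    rw [sigma_eq hskew, coordSplitting_point, coordSplitting_point]
    refine (mul_le_mul_of_nonneg_left (qnorm_le_mul_gdist _ _) (by positivity)).trans (le_of_eq ?_)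
    field_simp
  · have h3 : gdist (bracket b) (S.point A₁ 0) (S.point A₂ 0) = 0 := by
      refine le_antisymm ?_ (gdist_nonneg _ _)
      rw [coordSplitting_point_zero, coordSplitting_point_zero]
      exact (gdist_le_qnorm _ _).trans (not_lt.1 h0)
    have h4 : A₁ = A₂ := by
      rw [← S.coord_point A₁ 0, eq_of_gdist_eq_zero S.alternating h3, S.coord_point]
    subst h4
    simpa using mul_nonneg hε.le (gdist_nonneg _ _)

end

end Coordinates

section FrameMatrix

variable {m n k : ℕ}

lemma mulVec_eq_of_jacobian {l : ℕ} (J : (Fin m → ℝ) →L[ℝ] (Fin l → ℝ)) (x : Fin m → ℝ)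
    (j : Fin l) :
    ∑ i, J (Pi.single i 1) j * x i = J x j := by
  conv_rhs => rw [← Finset.univ_sum_single x, map_sum, Finset.sum_apply]
  refine Finset.sum_congr rfl fun i _ => ?_
  have : (Pi.single i (x i) : Fin m → ℝ) = x i • Pi.single i 1 := by
    rw [← Pi.single_smul, smul_eq_mul, mul_one]
  rw [this, map_smul, Pi.smul_apply, smul_eq_mul, mul_comm]

lemma isUnit_of_norm_mulVec_sub_le {M : Matrix (Fin k) (Fin k) ℝ}
    (h : ∀ v, ‖M.mulVec v - v‖ ≤ 1 / 2 * ‖v‖) : IsUnit M := by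
  refine Matrix.mulVec_injective_iff_isUnit.1 fun v w hvw => ?_
  have h1 := h (v - w)
  rw [Matrix.mulVec_sub, sub_eq_zero.2 hvw, zero_sub, norm_neg] at h1
  exact sub_eq_zero.1 (norm_eq_zero.1 (le_antisymm (by linarith) (norm_nonneg _)))

end FrameMatrix

/-- If `φ` is uniformly intrinsically differentiable at every point
of the open set `𝒪`, then around every point `Φ(A₀)` of its intrinsic graph there
are a ball `U(Φ(A₀),r)` and a `C¹_G` map `f` such that the graph coincides in the
ball with the zero level set of `f` and the square horizontal block `M₁` of `∇_G f`
is invertible throughout the ball. -/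
theorem statement5 (m n k : ℕ) (hm : 2 ≤ m) (hn : 1 ≤ n) (hk : 1 ≤ k) (hkm : k < m)
    (b : Fin n → Matrix (Fin m) (Fin m) ℝ)
    (hskew : ∀ s, (b s).transpose = -(b s)) (hind : LinearIndependent ℝ b)
    (hblock : ∀ s (i j : Fin m), (i : ℕ) < k → (j : ℕ) < k → b s i j = 0)
    (O : Set (W m n k)) (hO : IsOpen O) (φ : W m n k → Fin k → ℝ)
    (huid : ∀ A ∈ O, ∃ M, UID m n k b O φ A M) :
    ∀ A₀ ∈ O, ∃ r > 0, ∃ (f : G m n → Fin k → ℝ) (gradf : G m n → Matrix (Fin k) (Fin m) ℝ),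
      C1G m n k b (ball m n b (graphMap m n k b φ A₀) r) f gradf ∧
      (∀ P ∈ ball m n b (graphMap m n k b φ A₀) r,
        (P ∈ graphMap m n k b φ '' O ↔ f P = 0)) ∧
      ∀ Q ∈ ball m n b (graphMap m n k b φ A₀) r, IsUnit (M1 m n k hkm.le gradf Q) := by
  intro A₀ hA₀
  choose! M hM using huid
  set S := coordSplitting hkm.le hskew hblock
  obtain ⟨f, J, Ω, hΩ, hP₀, hf, hJ, hdiff, hzero, hinv⟩ := S.exists_defining_function hO
    (fun A hA => coordSplitting_unifDiffAt hn hO hA (hM A hA)) hA₀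
  have hgraph : (fun A => S.point A (φ A)) = graphMap m n k b φ :=
    funext fun A => coordSplitting_point A (φ A)
  obtain ⟨r, hr, hrΩ⟩ := exists_gdist_lt_subset S.alternating (hΩ.mem_nhds hP₀)
  rw [coordSplitting_point] at hrΩ
  have hball : ball m n b (graphMap m n k b φ A₀) r ⊆ Ω := fun Q hQ =>
    hrΩ Q ((gdist_le_qnorm _ _).trans_lt hQ)
  refine ⟨r, hr, f, fun P => Matrix.of fun j i => J P (Pi.single i 1) j,
    ⟨hf.mono hball, ?_, fun P hP ε hε => ?_⟩, fun P hP => ?_, fun Q hQ => ?_⟩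
  · refine continuousOn_pi.2 fun j => continuousOn_pi.2 fun i => ?_
    exact (continuous_apply j).comp_continuousOn
      ((hJ.mono hball).clm_apply continuousOn_const)
  · have hk0 : (0 : ℝ) < k := by exact_mod_cast hk
    obtain ⟨ρ, hρ, H⟩ := hdiff P (hball hP) (ε / k) (by positivity)
    refine ⟨ρ, hρ, fun Q _ hQ => ?_⟩
    have hg := gdist_le_qnorm (b := b) P Q
    have h1 := H Q (hg.trans_lt hQ)
    have e : (fun j => f Q j - f P j - ∑ i, Matrix.of (fun j i => J P (Pi.single i 1) j) j i *
        (Q.1 i - P.1 i)) = f Q - f P - J P (Q.1 - P.1) := by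
      ext j
      exact congrArg _ (mulVec_eq_of_jacobian (J P) (Q.1 - P.1) j)
    rw [e]
    calc _ ≤ k * ‖f Q - f P - J P (Q.1 - P.1)‖ := enorm_le_mul_norm _
      _ ≤ k * (ε / k * qnorm (gmul b (ginv P) Q)) := by
          gcongr
          exact h1.trans (by gcongr)
      _ = _ := by field_simp
  · rw [← hgraph]
    exact hzero P (hball hP)
  · refine isUnit_of_norm_mulVec_sub_le fun v => ?_
    have hsingle : ∀ i, S.inH (Pi.single i 1) = Pi.single (Fin.castLE hkm.le i) 1 := fun i => by
      ext j
      by_cases h : (j : ℕ) < k <;>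
        simp [S, coordSplitting, h, Pi.single_apply, Fin.ext_iff]
      omega
    have e : (M1 m n k hkm.le (fun P => Matrix.of fun j i => J P (Pi.single i 1) j) Q).mulVec v
        = J Q (S.inH v) := by
      ext j
      rw [← ContinuousLinearMap.comp_apply, ← mulVec_eq_of_jacobian]
      simp [M1, Matrix.mulVec, dotProduct, hsingle]
    rw [e]
    exact hinv Q (hball hQ) v

end Carnot
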